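/- arXiv:0803.0461 — 3 statements merged into one kernel-verified Lean document; each statement's English description precedes it below -/
import Mathlib

section
/- Let R be a commutative Noetherian ring, 𝔞 an ideal of R, and N a weakly Laskerian R-module of finite dimension. Let t be a positive integer such that H^i_𝔞(N) is Artinian for all i > t. Then the quotient module H^t_𝔞(N) / 𝔞·H^t_𝔞(N) is Artinian. -/
/-!
STATEMENT 7: Let R be a commutative Noetherian ring, 𝔞 an ideal of R, and N a weakly Laskerian
R-module of finite dimension. Let t be a positive integer such that H^i_𝔞(N) is Artinian for
all i > t. Then H^t_𝔞(N) / 𝔞·H^t_𝔞(N) is Artinian.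

`N` is weakly Laskerian iff every quotient of `N` has finitely many associated primes; `N` has
finite dimension iff the Krull dimension of its support is not `⊤`.
-/

open CategoryTheory Opposite

universe u

section LeftDerivedLES

open Limits

lemma CategoryTheory.ShortComplex.Exact.conj_iso {D : Type*} [Category* D] [Abelian D]
    {A B C A' B' C' : D} {f : A ⟶ B} {g : B ⟶ C} {w : f ≫ g = 0}
    (h : (ShortComplex.mk f g w).Exact) (a : A' ≅ A) (b : B' ≅ B) (c : C' ≅ C)
    {f' : A' ⟶ B'} {g' : B' ⟶ C'} (hf : f' = a.hom ≫ f ≫ b.inv) (hg : g' = b.hom ≫ g ≫ c.inv) :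
    ∃ w', (ShortComplex.mk f' g' w').Exact := by
  have w' : f' ≫ g' = 0 := by simp [hf, hg, reassoc_of% w]
  exact ⟨w', (ShortComplex.exact_iff_of_iso (S₁ := .mk f g w) (S₂ := .mk f' g' w')
    (ShortComplex.isoMk a.symm b.symm c.symm (by simp [hf]) (by simp [hg]))).1 h⟩

variable {C D : Type*} [Category* C] [Category* D] [Abelian C] [Abelian D]

/-- A pair of composable natural transformations `F ⟶ G ⟶ K` which is short exact on
projective objects. -/
structure ProjExactFunctors (F G K : C ⥤ D) where
  /-- The first natural transformation. -/
  f : F ⟶ G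
  /-- The second natural transformation. -/
  g : G ⟶ K
  zero : ∀ X, f.app X ≫ g.app X = 0
  exact : ∀ (P : C) [Projective P], (ShortComplex.mk (f.app P) (g.app P) (zero P)).ShortExact

namespace ProjExactFunctors

variable {F G K : C ⥤ D} [F.Additive] [G.Additive] [K.Additive] (T : ProjExactFunctors F G K)

/-- The short complex of chain complexes obtained by applying `F ⟶ G ⟶ K` to a chain complex. -/
noncomputable abbrev complexes (A : ChainComplex C ℕ) : ShortComplex (ChainComplex D ℕ) :=
  ShortComplex.mk ((NatTrans.mapHomologicalComplex T.f _).app A)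
    ((NatTrans.mapHomologicalComplex T.g _).app A) (by
      ext n
      exact T.zero _)

/-- The functoriality of `ProjExactFunctors.complexes`. -/
noncomputable abbrev complexesMap {A B : ChainComplex C ℕ} (φ : A ⟶ B) :
    T.complexes A ⟶ T.complexes B where
  τ₁ := (F.mapHomologicalComplex _).map φ
  τ₂ := (G.mapHomologicalComplex _).map φ
  τ₃ := (K.mapHomologicalComplex _).map φ
  comm₁₂ := ((NatTrans.mapHomologicalComplex T.f _).naturality φ)
  comm₂₃ := ((NatTrans.mapHomologicalComplex T.g _).naturality φ)

lemma complexes_shortExact {X : C} (P : ProjectiveResolution X) :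
    (T.complexes P.complex).ShortExact :=
  HomologicalComplex.shortExact_of_degreewise_shortExact _ fun n => T.exact (P.complex.X n)

variable [EnoughProjectives C]

/-- The connecting morphism between left derived functors. -/
noncomputable def δ (n : ℕ) : K.leftDerived (n + 1) ⟶ F.leftDerived n where
  app X := ((projectiveResolution X).isoLeftDerivedObj K (n + 1)).hom ≫
    (show (HomologicalComplex.homologyFunctor D _ (n + 1)).obj
      ((K.mapHomologicalComplex _).obj (projectiveResolution X).complex) ⟶
      (HomologicalComplex.homologyFunctor D _ n).obj
        ((F.mapHomologicalComplex _).obj (projectiveResolution X).complex) from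
    (T.complexes_shortExact (projectiveResolution X)).δ (n + 1) n (by simp)) ≫
    ((projectiveResolution X).isoLeftDerivedObj F n).inv
  naturality X Y f := by
    let P := projectiveResolution X
    let Q := projectiveResolution Y
    let φ : P.complex ⟶ Q.complex := ProjectiveResolution.lift f P Q
    have comm : φ.f 0 ≫ Q.π.f 0 = P.π.f 0 ≫ f := ProjectiveResolution.lift_commutes_zero ..
    have key {A A' B B' a a' b b' : D} (h₁ : A ⟶ A') (e' : A' ⟶ a') (e : A ⟶ a) (h₂ : a ⟶ a')
        (i : b ⟶ B) (h₃ : B ⟶ B') (h₄ : b ⟶ b') (i' : b' ⟶ B') (d : a ⟶ b) (d' : a' ⟶ b')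
        (e₁ : h₁ ≫ e' = e ≫ h₂) (e₂ : i ≫ h₃ = h₄ ≫ i') (e₃ : d ≫ h₄ = h₂ ≫ d') :
        h₁ ≫ e' ≫ d' ≫ i' = (e ≫ d ≫ i) ≫ h₃ := by
      rw [reassoc_of% e₁, ← reassoc_of% e₃, Category.assoc, Category.assoc, e₂]
    exact key _ _ _ _ _ _ _ _ _ _ (P.isoLeftDerivedObj_hom_naturality f Q φ comm K (n + 1))
      (P.isoLeftDerivedObj_inv_naturality f Q φ comm F n)
      (HomologicalComplex.HomologySequence.δ_naturality (T.complexesMap φ)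
        (T.complexes_shortExact P) (T.complexes_shortExact Q) (n + 1) n (by simp))

lemma δ_app_exact₁ (n : ℕ) (X : C) :
    ∃ w, (ShortComplex.mk ((T.δ n).app X) ((NatTrans.leftDerived T.f n).app X) w).Exact :=
  let P := projectiveResolution X
  ((T.complexes_shortExact P).homology_exact₁ (n + 1) n (by simp)).conj_iso
    (P.isoLeftDerivedObj K (n + 1)) (P.isoLeftDerivedObj F n) (P.isoLeftDerivedObj G n)
    rfl (P.leftDerived_app_eq T.f n)

lemma δ_app_exact₃ (n : ℕ) (X : C) :
    ∃ w, (ShortComplex.mk ((NatTrans.leftDerived T.g (n + 1)).app X) ((T.δ n).app X) w).Exact :=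
  let P := projectiveResolution X
  ((T.complexes_shortExact P).homology_exact₃ (n + 1) n (by simp)).conj_iso
    (P.isoLeftDerivedObj G (n + 1)) (P.isoLeftDerivedObj K (n + 1)) (P.isoLeftDerivedObj F n)
    (P.leftDerived_app_eq T.g (n + 1)) rfl

lemma app_exact₂ (n : ℕ) (X : C) :
    ∃ w, (ShortComplex.mk ((NatTrans.leftDerived T.f n).app X)
      ((NatTrans.leftDerived T.g n).app X) w).Exact :=
  let P := projectiveResolution X
  ((T.complexes_shortExact P).homology_exact₂ n).conj_iso
    (P.isoLeftDerivedObj F n) (P.isoLeftDerivedObj G n) (P.isoLeftDerivedObj K n)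
    (P.leftDerived_app_eq T.f n) (P.leftDerived_app_eq T.g n)

end ProjExactFunctors

end LeftDerivedLES

section ExtLES

open Limits

variable {R : Type u} [CommRing R]

/-- A short exact sequence in the second variable of `Hom` gives a sequence of functors which is
exact on projective objects. -/
noncomputable def CategoryTheory.ShortComplex.ShortExact.projExactFunctors
    {S : ShortComplex (ModuleCat.{u} R)} (hS : S.ShortExact) :
    ProjExactFunctors ((linearYoneda R (ModuleCat.{u} R)).obj S.X₃).rightOp
      ((linearYoneda R (ModuleCat.{u} R)).obj S.X₂).rightOp
      ((linearYoneda R (ModuleCat.{u} R)).obj S.X₁).rightOp where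
  f := NatTrans.rightOp ((linearYoneda R (ModuleCat.{u} R)).map S.g)
  g := NatTrans.rightOp ((linearYoneda R (ModuleCat.{u} R)).map S.f)
  zero X := by
    apply Quiver.Hom.unop_inj
    apply ModuleCat.hom_ext
    apply LinearMap.ext
    intro (x : X ⟶ S.X₁)
    change (x ≫ S.f) ≫ S.g = 0
    rw [Category.assoc, S.zero, comp_zero]
  exact P _ := by
    have := hS.mono_f
    have := hS.epi_g
    have w : ((linearYoneda R (ModuleCat.{u} R)).map S.f).app (Opposite.op P) ≫
      ((linearYoneda R (ModuleCat.{u} R)).map S.g).app (Opposite.op P) = 0 := by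
      apply ModuleCat.hom_ext
      apply LinearMap.ext
      intro (x : P ⟶ S.X₁)
      change (x ≫ S.f) ≫ S.g = 0
      rw [Category.assoc, S.zero, comp_zero]
    have hex : (ShortComplex.mk _ _ w).ShortExact :=
      { exact := by
          rw [ShortComplex.moduleCat_exact_iff]
          intro (x : P ⟶ S.X₂) hx
          exact ⟨hS.exact.lift x hx, hS.exact.lift_f x hx⟩
        mono_f := by
          rw [ModuleCat.mono_iff_injective]
          intro (x : P ⟶ S.X₁) (y : P ⟶ S.X₁) hxy
          exact (cancel_mono S.f).1 hxy
        epi_g := by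
          rw [ModuleCat.epi_iff_surjective]
          intro (x : P ⟶ S.X₃)
          exact ⟨Projective.factorThru x S.g, Projective.factorThru_comp x S.g⟩ }
    exact hex.op

variable {S : ShortComplex (ModuleCat.{u} R)}

lemma Ext_map_exact (hS : S.ShortExact) (n : ℕ) (X : (ModuleCat.{u} R)ᵒᵖ) :
    Function.Exact (((Ext R (ModuleCat.{u} R) n).obj X).map S.f)
      (((Ext R (ModuleCat.{u} R) n).obj X).map S.g) := by
  obtain ⟨w, h⟩ := hS.projExactFunctors.app_exact₂ n X.unop
  exact (ShortComplex.ShortExact.moduleCat_exact_iff_function_exact _).1 h.unop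

/-- The connecting homomorphism for `Ext`, as a natural transformation in the first variable. -/
noncomputable def CategoryTheory.ShortComplex.ShortExact.extδ (hS : S.ShortExact) (n : ℕ) :
    (Ext R (ModuleCat.{u} R) n).flip.obj S.X₃ ⟶ (Ext R (ModuleCat.{u} R) (n + 1)).flip.obj S.X₁ :=
  NatTrans.leftOp (hS.projExactFunctors.δ n)

lemma Ext_map_extδ_exact (hS : S.ShortExact) (n : ℕ) (X : (ModuleCat.{u} R)ᵒᵖ) :
    Function.Exact (((Ext R (ModuleCat.{u} R) n).obj X).map S.g) ((hS.extδ n).app X) := by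
  obtain ⟨w, h⟩ := hS.projExactFunctors.δ_app_exact₁ n X.unop
  exact (ShortComplex.ShortExact.moduleCat_exact_iff_function_exact _).1 h.unop

lemma Ext_extδ_map_exact (hS : S.ShortExact) (n : ℕ) (X : (ModuleCat.{u} R)ᵒᵖ) :
    Function.Exact ((hS.extδ n).app X) (((Ext R (ModuleCat.{u} R) (n + 1)).obj X).map S.f) := by
  obtain ⟨w, h⟩ := hS.projExactFunctors.δ_app_exact₃ n X.unop
  exact (ShortComplex.ShortExact.moduleCat_exact_iff_function_exact _).1 h.unop

end ExtLES

section Colimit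

open Limits

variable {R : Type u} [CommRing R] {J : Type} [SmallCategory J] [IsFiltered J]

lemma ModuleCat.exact_of_isColimit {A B C : J ⥤ ModuleCat.{u} R} {cA : Cocone A} {cB : Cocone B}
    {cC : Cocone C} (hB : IsColimit cB) (hC : IsColimit cC) (hA : IsColimit cA)
    (f : A ⟶ B) (g : B ⟶ C)
    (h : ∀ j, Function.Exact (f.app j) (g.app j)) (f' : cA.pt ⟶ cB.pt) (g' : cB.pt ⟶ cC.pt)
    (hf : ∀ j, cA.ι.app j ≫ f' = f.app j ≫ cB.ι.app j)
    (hg : ∀ j, cB.ι.app j ≫ g' = g.app j ≫ cC.ι.app j) :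
    Function.Exact f' g' := by
  have : PreservesFilteredColimitsOfSize.{0, 0} (forget (ModuleCat.{u} R)) :=
    preservesFilteredColimitsOfSize_shrink.{0, u, 0, u} _
  have hf' (j) (x : A.obj j) : f' (cA.ι.app j x) = cB.ι.app j (f.app j x) :=
    ConcreteCategory.congr_hom (hf j) x
  have hg' (j) (x : B.obj j) : g' (cB.ι.app j x) = cC.ι.app j (g.app j x) :=
    ConcreteCategory.congr_hom (hg j) x
  intro y
  constructor
  · intro hy
    obtain ⟨j, y, rfl⟩ := Concrete.isColimit_exists_rep B hB y
    rw [hg', ← map_zero (cC.ι.app j).hom] at hy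
    obtain ⟨k, a, b, hab⟩ := (Concrete.isColimit_rep_eq_iff_exists C hC _ _).1 hy
    have h0 : g.app k (B.map a y) = 0 := by
      have := ConcreteCategory.congr_hom (g.naturality a) y
      refine this.trans (hab.trans ?_)
      exact map_zero _
    obtain ⟨x, hx⟩ := (h k _).1 h0
    refine ⟨cA.ι.app k x, ?_⟩
    rw [hf', hx]
    exact ConcreteCategory.congr_hom (cB.w a) y
  · rintro ⟨x, rfl⟩
    obtain ⟨j, x, rfl⟩ := Concrete.isColimit_exists_rep A hA x
    rw [hf', hg', (h j _).2 ⟨x, rfl⟩]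
    exact map_zero _

end Colimit

section LocalCohomology

open Limits

namespace localCohomology

variable {R : Type u} [CommRing R] (𝔞 : Ideal R)

/-- The colimit cocone defining the value of local cohomology on a module. -/
noncomputable def coconeObj (i : ℕ) (M : ModuleCat.{u} R) :
    Cocone (diagram (idealPowersDiagram 𝔞) i ⋙ (evaluation _ _).obj M) :=
  ((evaluation _ _).obj M).mapCocone (colimit.cocone (diagram (idealPowersDiagram 𝔞) i))

/-- The cocone defining local cohomology is a colimit. -/
noncomputable def isColimitCoconeObj (i : ℕ) (M : ModuleCat.{u} R) :
    IsColimit (coconeObj 𝔞 i M) :=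
  isColimitOfPreserves ((evaluation _ _).obj M)
    (colimit.isColimit (diagram (idealPowersDiagram 𝔞) i))

variable {S : ShortComplex (ModuleCat.{u} R)}

/-- The connecting homomorphism on the terms of the colimit defining local cohomology. -/
noncomputable def diagramδ (hS : S.ShortExact) (i : ℕ) :
    diagram (idealPowersDiagram 𝔞) i ⋙ (evaluation _ _).obj S.X₃ ⟶
      diagram (idealPowersDiagram 𝔞) (i + 1) ⋙ (evaluation _ _).obj S.X₁ :=
  Functor.whiskerLeft (ringModIdeals (idealPowersDiagram 𝔞)).op (hS.extδ i)

/-- The map on the diagrams defining local cohomology. -/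
noncomputable abbrev diagramMap (i : ℕ) {M N : ModuleCat.{u} R} (f : M ⟶ N) :
    diagram (idealPowersDiagram 𝔞) i ⋙ (evaluation _ _).obj M ⟶
      diagram (idealPowersDiagram 𝔞) i ⋙ (evaluation _ _).obj N :=
  Functor.whiskerLeft _ ((evaluation _ _).map f)

/-- The connecting homomorphism of local cohomology. -/
noncomputable def δ (hS : S.ShortExact) (i : ℕ) :
    (localCohomology 𝔞 i).obj S.X₃ ⟶ (localCohomology 𝔞 (i + 1)).obj S.X₁ :=
  (isColimitCoconeObj 𝔞 i S.X₃).map (coconeObj 𝔞 (i + 1) S.X₁) (diagramδ 𝔞 hS i)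

lemma coconeObj_ι_map (i : ℕ) {M N : ModuleCat.{u} R} (f : M ⟶ N) (j) :
    (coconeObj 𝔞 i M).ι.app j ≫ (localCohomology 𝔞 i).map f =
      (diagramMap 𝔞 i f).app j ≫ (coconeObj 𝔞 i N).ι.app j :=
  (((colimit.cocone (diagram (idealPowersDiagram 𝔞) i)).ι.app j).naturality f).symm

lemma map_exact (hS : S.ShortExact) (i : ℕ) :
    Function.Exact ((localCohomology 𝔞 i).map S.f) ((localCohomology 𝔞 i).map S.g) :=
  ModuleCat.exact_of_isColimit (isColimitCoconeObj 𝔞 i _) (isColimitCoconeObj 𝔞 i _)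
    (isColimitCoconeObj 𝔞 i _) (diagramMap 𝔞 i S.f) (diagramMap 𝔞 i S.g)
    (fun _ => Ext_map_exact hS i _) _ _ (coconeObj_ι_map 𝔞 i _) (coconeObj_ι_map 𝔞 i _)

lemma map_δ_exact (hS : S.ShortExact) (i : ℕ) :
    Function.Exact ((localCohomology 𝔞 i).map S.g) (δ 𝔞 hS i) :=
  ModuleCat.exact_of_isColimit (isColimitCoconeObj 𝔞 i _) (isColimitCoconeObj 𝔞 _ _)
    (isColimitCoconeObj 𝔞 i _) (diagramMap 𝔞 i S.g) (diagramδ 𝔞 hS i)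
    (fun _ => Ext_map_extδ_exact hS i _) _ _ (coconeObj_ι_map 𝔞 i _)
    ((isColimitCoconeObj 𝔞 i S.X₃).ι_map _ (diagramδ 𝔞 hS i))

lemma δ_map_exact (hS : S.ShortExact) (i : ℕ) :
    Function.Exact (δ 𝔞 hS i) ((localCohomology 𝔞 (i + 1)).map S.f) :=
  ModuleCat.exact_of_isColimit (isColimitCoconeObj 𝔞 _ _) (isColimitCoconeObj 𝔞 _ _)
    (isColimitCoconeObj 𝔞 i _) (diagramδ 𝔞 hS i) (diagramMap 𝔞 (i + 1) S.f)
    (fun _ => Ext_extδ_map_exact hS i _) _ _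
    ((isColimitCoconeObj 𝔞 i S.X₃).ι_map _ (diagramδ 𝔞 hS i)) (coconeObj_ι_map 𝔞 _ _)

end localCohomology

end LocalCohomology

section ExtProperties

open Limits

variable {C D : Type*} [Category* C] [Category* D] [Abelian C] [Abelian D]

lemma HomologicalComplex.homologyMap_eq_of_natTrans_id {ι : Type*} {c : ComplexShape ι}
    (ε : 𝟭 D ⟶ 𝟭 D) {K : HomologicalComplex D c} (φ : K ⟶ K)
    (hφ : ∀ n, φ.f n = ε.app (K.X n)) (n : ι) :
    HomologicalComplex.homologyMap φ n = ε.app (K.homology n) := by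
  have h₁ : HomologicalComplex.cyclesMap φ n = ε.app (K.cycles n) := by
    rw [← cancel_mono (K.iCycles n), HomologicalComplex.cyclesMap_i, hφ]
    exact ε.naturality (K.iCycles n)
  rw [← cancel_epi (K.homologyπ n), HomologicalComplex.homologyπ_naturality, h₁]
  exact (ε.naturality (K.homologyπ n)).symm

lemma CategoryTheory.NatTrans.leftDerived_app_eq_of_natTrans_id [EnoughProjectives C]
    (ε : 𝟭 D ⟶ 𝟭 D) {F : C ⥤ D} [F.Additive] (α : F ⟶ F)
    (hα : ∀ X, α.app X = ε.app (F.obj X)) (n : ℕ) (X : C) :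
    (NatTrans.leftDerived α n).app X = ε.app ((F.leftDerived n).obj X) := by
  have key {A B : D} (e : A ≅ B) (f : B ⟶ B) (hf : f = ε.app B) :
      e.hom ≫ f ≫ e.inv = ε.app A := by
    have h : e.hom ≫ ε.app B = ε.app A ≫ e.hom := ε.naturality e.hom
    rw [hf, reassoc_of% h, Iso.hom_inv_id, Category.comp_id]
  rw [(projectiveResolution X).leftDerived_app_eq]
  exact key _ _ (HomologicalComplex.homologyMap_eq_of_natTrans_id ε _ (fun _ => hα _) n)

lemma CategoryTheory.NatTrans.leftDerived_comp_fromLeftDerivedZero [EnoughProjectives C]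
    {F G : C ⥤ D} [F.Additive] [G.Additive] (α : F ⟶ G) (X : C) :
    (NatTrans.leftDerived α 0).app X ≫ G.fromLeftDerivedZero.app X =
      F.fromLeftDerivedZero.app X ≫ α.app X := by
  let P := projectiveResolution X
  let φ := (NatTrans.mapHomologicalComplex α (ComplexShape.down ℕ)).app P.complex
  have h₁ : HomologicalComplex.opcyclesMap φ 0 ≫ P.fromLeftDerivedZero' G =
      P.fromLeftDerivedZero' F ≫ α.app X := by
    rw [← cancel_epi (HomologicalComplex.pOpcycles _ _),
      HomologicalComplex.p_opcyclesMap_assoc, P.pOpcycles_comp_fromLeftDerivedZero',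
      P.pOpcycles_comp_fromLeftDerivedZero'_assoc]
    exact (α.naturality _).symm
  have h₂ := HomologicalComplex.homologyι_naturality φ 0
  have key {A A' B B' E E' Y Y' : D} (a : A ≅ B) (a' : A' ≅ B') (b : B ⟶ B') (c : B ⟶ E)
      (c' : B' ⟶ E') (d : E ⟶ E') (e : E ⟶ Y) (e' : E' ⟶ Y') (f : Y ⟶ Y')
      (h₁ : d ≫ e' = e ≫ f) (h₂ : b ≫ c' = c ≫ d) :
      (a.hom ≫ b ≫ a'.inv) ≫ a'.hom ≫ c' ≫ e' = (a.hom ≫ c ≫ e) ≫ f := by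
    simp [reassoc_of% h₂, h₁]
  rw [P.leftDerived_app_eq, P.fromLeftDerivedZero_eq, P.fromLeftDerivedZero_eq]
  exact key _ _ _ _ _ _ _ _ _ h₁ h₂

variable {R : Type u} [CommRing R]

lemma Ext_map_smul_id (n : ℕ) (X : (ModuleCat.{u} R)ᵒᵖ) (M : ModuleCat.{u} R) (x : R)
    (y : ((Ext R (ModuleCat.{u} R) n).obj X).obj M) :
    ((Ext R (ModuleCat.{u} R) n).obj X).map (x • 𝟙 M) y = x • y := by
  let ε : 𝟭 (ModuleCat.{u} R)ᵒᵖ ⟶ 𝟭 (ModuleCat.{u} R)ᵒᵖ :=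
    { app Y := (x • 𝟙 Y.unop).op
      naturality Y Z f := Quiver.Hom.unop_inj (by simp) }
  have h := NatTrans.leftDerived_app_eq_of_natTrans_id ε
    (NatTrans.rightOp ((linearYoneda R (ModuleCat.{u} R)).map (x • 𝟙 M))) (fun P => by
      apply Quiver.Hom.unop_inj
      apply ModuleCat.hom_ext
      apply LinearMap.ext
      intro (y : P ⟶ M)
      change y ≫ (x • 𝟙 M) = x • y
      simp) n X.unop
  exact ConcreteCategory.congr_hom (congrArg Quiver.Hom.unop h) y

lemma subsingleton_Ext_succ_of_injective (X : (ModuleCat.{u} R)ᵒᵖ) (E : ModuleCat.{u} R)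
    [Injective E] (n : ℕ) :
    Subsingleton (((Ext R (ModuleCat.{u} R) (n + 1)).obj X).obj E) := by
  let P := projectiveResolution X.unop
  apply ModuleCat.subsingleton_of_isZero
  refine IsZero.of_iso ?_ (P.isoExt (n + 1) E)
  rw [← HomologicalComplex.exactAt_iff_isZero_homology,
    HomologicalComplex.exactAt_iff' _ n (n + 1) (n + 2) (by simp) (by simp),
    ShortComplex.moduleCat_exact_iff]
  intro (φ : P.complex.X (n + 1) ⟶ E) hφ
  have hφ' : P.complex.d (n + 2) (n + 1) ≫ φ = 0 := hφ
  have hP := P.complex_exactAt_succ n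
  rw [HomologicalComplex.exactAt_iff' _ (n + 2) (n + 1) n (by simp) (by simp)] at hP
  exact ⟨hP.descToInjective φ hφ', hP.comp_descToInjective φ hφ'⟩

/-- The comparison map from `Hom` to `Ext` in degree zero. -/
noncomputable def extZeroOfHom (X : (ModuleCat.{u} R)ᵒᵖ) (Y : ModuleCat.{u} R)
    (f : X.unop ⟶ Y) : ((Ext R (ModuleCat.{u} R) 0).obj X).obj Y :=
  (((linearYoneda R (ModuleCat.{u} R)).obj Y).rightOp.fromLeftDerivedZero.app X.unop).unop f

lemma extZeroOfHom_surjective (X : (ModuleCat.{u} R)ᵒᵖ) (Y : ModuleCat.{u} R) :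
    Function.Surjective (extZeroOfHom X Y) := by
  have : PreservesFiniteColimits ((linearYoneda R (ModuleCat.{u} R)).obj Y).rightOp := by
    have : PreservesFiniteLimits ((linearYoneda R (ModuleCat.{u} R)).obj Y) := ⟨fun J _ _ => by
      have : PreservesLimitsOfShape J ((linearYoneda R (ModuleCat.{u} R)).obj Y ⋙ forget _) :=
        inferInstanceAs (PreservesLimitsOfShape J (yoneda.obj Y))
      exact preservesLimitsOfShape_of_reflects_of_preserves _ (forget _)⟩
    exact preservesFiniteColimits_rightOp _
  have : IsIso (((linearYoneda R (ModuleCat.{u} R)).obj Y).rightOp.fromLeftDerivedZero.app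
    X.unop).unop := inferInstance
  exact (ConcreteCategory.bijective_of_isIso (((linearYoneda R
    (ModuleCat.{u} R)).obj Y).rightOp.fromLeftDerivedZero.app X.unop).unop).2

lemma Ext_zero_map_extZeroOfHom (X : (ModuleCat.{u} R)ᵒᵖ) {Y Z : ModuleCat.{u} R}
    (f : X.unop ⟶ Y) (g : Y ⟶ Z) :
    ((Ext R (ModuleCat.{u} R) 0).obj X).map g (extZeroOfHom X Y f) =
      extZeroOfHom X Z (f ≫ g) := by
  have h := NatTrans.leftDerived_comp_fromLeftDerivedZero
    (NatTrans.rightOp ((linearYoneda R (ModuleCat.{u} R)).map g)) X.unop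
  exact ConcreteCategory.congr_hom (congrArg Quiver.Hom.unop h) f

lemma Ext_zero_map_left_extZeroOfHom {X X' : (ModuleCat.{u} R)ᵒᵖ} (a : X ⟶ X')
    (Y : ModuleCat.{u} R) (f : X.unop ⟶ Y) :
    ((Ext R (ModuleCat.{u} R) 0).map a).app Y (extZeroOfHom X Y f) =
      extZeroOfHom X' Y (a.unop ≫ f) := by
  have h := ((linearYoneda R (ModuleCat.{u} R)).obj Y).rightOp.fromLeftDerivedZero.naturality
    a.unop
  exact ConcreteCategory.congr_hom (congrArg Quiver.Hom.unop h) f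

end ExtProperties

section Algebra

variable {R : Type*} [CommRing R]

lemma LinearMap.isArtinian_range_of_ker_le {P A B : Type*} [AddCommGroup P] [AddCommGroup A]
    [AddCommGroup B] [Module R P] [Module R A] [Module R B] (f : P →ₗ[R] A) (g : P →ₗ[R] B)
    (h : LinearMap.ker f ≤ LinearMap.ker g) [IsArtinian R A] :
    IsArtinian R (LinearMap.range g) := by
  have : IsArtinian R (P ⧸ LinearMap.ker f) := isArtinian_of_linearEquiv f.quotKerEquivRange.symm
  have h' : LinearMap.range g = LinearMap.range ((LinearMap.ker f).liftQ g h) :=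
    (Submodule.range_liftQ _ _ _).symm
  rw [h']
  infer_instance

lemma Submodule.mem_ideal_smul_top_iff_exists_sum {M : Type*} [AddCommGroup M] [Module R M]
    {n : ℕ} (a : Fin n → R) (m : M) :
    m ∈ (Ideal.span (Set.range a) • ⊤ : Submodule R M) ↔ ∃ v : Fin n → M, ∑ j, a j • v j = m := by
  constructor
  · intro hm
    induction hm using Submodule.smul_induction_on' with
    | smul r hr m _ =>
      obtain ⟨c, rfl⟩ := (Submodule.mem_span_range_iff_exists_fun R).1 hr
      exact ⟨fun j => c j • m, by simp [Finset.sum_smul, smul_smul, mul_comm]⟩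
    | add x _ y _ hx hy =>
      obtain ⟨v, rfl⟩ := hx
      obtain ⟨w, rfl⟩ := hy
      exact ⟨v + w, by simp [Finset.sum_add_distrib]⟩
  · rintro ⟨v, rfl⟩
    exact Submodule.sum_mem _ fun j _ =>
      Submodule.smul_mem_smul (Ideal.subset_span ⟨j, rfl⟩) Submodule.mem_top

/-- If `H → V → K` is exact, `K` and `V / 𝔞 V` are Artinian and the kernel of `H → V` is contained
in `𝔞 H`, then `H / 𝔞 H` is Artinian. -/
lemma isArtinian_quotient_ideal_smul_top_of_exact {𝔞 : Ideal R} (h𝔞 : 𝔞.FG)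
    {H V K : Type*} [AddCommGroup H] [AddCommGroup V] [AddCommGroup K] [Module R H] [Module R V]
    [Module R K] (p : H →ₗ[R] V) (q : V →ₗ[R] K) (hpq : Function.Exact p q)
    (hp : LinearMap.ker p ≤ 𝔞 • ⊤) [IsArtinian R K]
    [IsArtinian R (V ⧸ (𝔞 • ⊤ : Submodule R V))] :
    IsArtinian R (H ⧸ (𝔞 • ⊤ : Submodule R H)) := by
  obtain ⟨n, a, rfl⟩ := Submodule.fg_iff_exists_fin_generating_family.1 h𝔞
  rw [← Ideal.span] at *
  set 𝔞 := Ideal.span (Set.range a)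
  let s : (Fin n → V) →ₗ[R] V := ∑ j, a j • LinearMap.proj j
  have hs (v : Fin n → V) : s v = ∑ j, a j • v j := by simp [s]
  let W : Submodule R (H × (Fin n → V)) :=
    LinearMap.eqLocus (p ∘ₗ LinearMap.fst R H (Fin n → V)) (s ∘ₗ LinearMap.snd R H (Fin n → V))
  let f : W →ₗ[R] (Fin n → K) := q.compLeft (Fin n) ∘ₗ LinearMap.snd R H (Fin n → V) ∘ₗ W.subtype
  let g : W →ₗ[R] H ⧸ (𝔞 • ⊤ : Submodule R H) :=
    (𝔞 • ⊤ : Submodule R H).mkQ ∘ₗ LinearMap.fst R H (Fin n → V) ∘ₗ W.subtype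
  have hfg : LinearMap.ker f ≤ LinearMap.ker g := by
    rintro ⟨⟨h, v⟩, hw : p h = s v⟩ hf
    have hv (j) : q (v j) = 0 := congrFun hf j
    choose w hw' using fun j => (hpq (v j)).1 (hv j)
    have h₁ : h - ∑ j, a j • w j ∈ (𝔞 • ⊤ : Submodule R H) := by
      apply hp
      simp [hw, hs, hw']
    have h₂ : ∑ j, a j • w j ∈ (𝔞 • ⊤ : Submodule R H) :=
      (Submodule.mem_ideal_smul_top_iff_exists_sum a _).2 ⟨w, rfl⟩
    change Submodule.Quotient.mk h = 0
    rw [Submodule.Quotient.mk_eq_zero]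
    simpa using add_mem h₁ h₂
  have := LinearMap.isArtinian_range_of_ker_le f g hfg
  have hle : (𝔞 • ⊤ : Submodule R H) ≤ (𝔞 • ⊤ : Submodule R V).comap p := by
    rw [← Submodule.map_le_iff_le_comap, Submodule.map_smul'']
    exact Submodule.smul_mono le_rfl le_top
  refine isArtinian_of_range_eq_ker (LinearMap.range g).subtype
    (Submodule.mapQ _ (𝔞 • ⊤ : Submodule R V) p hle) ?_
  rw [Submodule.range_subtype]
  ext y
  obtain ⟨y, rfl⟩ := Submodule.Quotient.mk_surjective _ y
  rw [LinearMap.mem_ker, Submodule.mapQ_apply, Submodule.Quotient.mk_eq_zero,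
    Submodule.mem_ideal_smul_top_iff_exists_sum a]
  constructor
  · rintro ⟨⟨⟨h, v⟩, hw : p h = s v⟩, hg : Submodule.Quotient.mk h = Submodule.Quotient.mk y⟩
    rw [Submodule.Quotient.eq] at hg
    obtain ⟨w, hw'⟩ := (Submodule.mem_ideal_smul_top_iff_exists_sum a _).1 (hle hg)
    refine ⟨v - w, ?_⟩
    simp [smul_sub, hw', ← hs, ← hw]
  · rintro ⟨v, hv⟩
    exact ⟨⟨⟨y, v⟩, show p y = s v by rw [hs, hv]⟩, rfl⟩

variable [IsNoetherianRing R]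

lemma exists_mem_ideal_isSMulRegular {𝔞 : Ideal R} {M : Type*} [AddCommGroup M] [Module R M]
    (hfin : (associatedPrimes R M).Finite)
    (h : ∀ m : M, (∀ r ∈ 𝔞, r • m = 0) → m = 0) :
    ∃ x ∈ 𝔞, IsSMulRegular M x := by
  by_contra! hx
  have hsub : (𝔞 : Set R) ⊆ ⋃ p ∈ associatedPrimes R M, p := by
    intro x hx𝔞
    rw [biUnion_associatedPrimes_eq_zero_divisors]
    by_contra hm
    refine hx x hx𝔞 (isSMulRegular_iff_right_eq_zero_of_smul.2 fun m hm' => ?_)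
    by_contra h0
    exact hm ⟨m, h0, hm'⟩
  have := (Ideal.subset_union_prime_finite hfin (f := id) ⊥ ⊥
    (fun p hp _ _ => hp.isPrime)).1 hsub
  obtain ⟨p, hp, hle⟩ := this
  obtain ⟨hprime, m, rfl⟩ := (isAssociatedPrime_iff).1 hp
  have hm : m = 0 := h m fun r hr => by
    simpa [Submodule.mem_colon_singleton] using hle hr
  exact hprime.ne_top (by simp [hm])

lemma exists_associatedPrime_le_of_mem_support {M : Type*} [AddCommGroup M] [Module R M]
    {p : PrimeSpectrum R} (hp : p ∈ Module.support R M) :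
    ∃ q ∈ associatedPrimes R M, q ≤ p.asIdeal := by
  obtain ⟨m, hm⟩ := Module.mem_support_iff'.1 hp
  have h : p ∈ Module.support R (R ∙ m) :=
    Module.mem_support_iff'.2 ⟨⟨m, Submodule.mem_span_singleton_self m⟩, fun r hr h0 =>
      hm r hr (congrArg Subtype.val h0)⟩
  obtain ⟨q, hq, hle⟩ := Ideal.exists_minimalPrimes_le (Module.mem_support_iff_of_finite.1 h)
  exact ⟨q, associatedPrimes.subset_of_injective (Submodule.injective_subtype _)
    (Module.associatedPrimes.minimalPrimes_annihilator_subset_associatedPrimes R _ hq), hle⟩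

/-- The dimension of the support drops after killing a regular element, without any finiteness
assumption on the module. -/
lemma supportDim_add_one_le_of_isSMulRegular {M Q : Type*} [AddCommGroup M] [Module R M]
    [AddCommGroup Q] [Module R Q] (f : M →ₗ[R] Q) (hf : Function.Surjective f) {x : R}
    (hx : IsSMulRegular M x) (hQ : ∀ y : Q, x • y = 0) :
    Module.supportDim R Q + 1 ≤ Module.supportDim R M := by
  nontriviality Q
  have : Nontrivial M := hf.nontrivial
  have le : Module.support R Q ⊆ Module.support R M := Module.support_subset_of_surjective f hf
  have : Nonempty (Module.support R M) := Module.nonempty_support_of_nontrivial.to_subtype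
  have : Nonempty (Module.support R Q) := Module.nonempty_support_of_nontrivial.to_subtype
  simp only [Module.supportDim, Order.krullDim_eq_iSup_length]
  apply WithBot.coe_le_coe.mpr
  simp only [ENat.iSup_add, iSup_le_iff]
  intro p
  have hp : x ∈ p.head.1.asIdeal := by
    obtain ⟨m, hm⟩ := Module.mem_support_iff'.1 p.head.2
    by_contra h
    exact hm x h (hQ m)
  let q : LTSeries (Module.support R M) :=
    p.map (Set.MapsTo.restrict id (Module.support R Q) (Module.support R M) le) (fun _ _ h ↦ h)
  obtain ⟨r, hr, hle⟩ := exists_associatedPrime_le_of_mem_support q.head.2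
  obtain ⟨hprime, m, hm⟩ := isAssociatedPrime_iff.1 hr
  have hxr : x ∉ r := fun h => by
    have hm0 : m = 0 := hx.right_eq_zero_of_smul (by
      simpa [hm, Submodule.mem_colon_singleton] using h)
    exact hprime.ne_top (by simp [hm, hm0])
  let r' : Module.support R M := ⟨⟨r, hprime⟩, Module.mem_support_iff'.2 ⟨m, fun c hc h0 => hc (by
    simpa [hm, Submodule.mem_colon_singleton] using h0)⟩⟩
  have hlt : r' < q.head := lt_of_le_of_ne hle fun h => hxr (by
    have : r = q.head.1.asIdeal := by rw [← h]
    rw [this]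
    exact hp)
  exact le_of_eq_of_le (by simp; rfl) (le_iSup _ (q.cons r' hlt))

end Algebra

section IdealPowerTorsion

variable {R : Type*} [CommRing R]

/-- The submodule of elements killed by some power of `𝔞`. -/
def Submodule.idealPowerTorsion (𝔞 : Ideal R) (M : Type*) [AddCommGroup M] [Module R M] :
    Submodule R M where
  carrier := {m | ∃ k : ℕ, ∀ r ∈ 𝔞 ^ k, r • m = 0}
  zero_mem' := ⟨0, fun _ _ => smul_zero _⟩
  add_mem' := by
    rintro m n ⟨k, hk⟩ ⟨l, hl⟩
    refine ⟨k + l, fun r hr => ?_⟩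
    rw [smul_add, hk r (Ideal.pow_le_pow_right (Nat.le_add_right k l) hr),
      hl r (Ideal.pow_le_pow_right (Nat.le_add_left l k) hr), add_zero]
  smul_mem' := by
    rintro c m ⟨k, hk⟩
    exact ⟨k, fun r hr => by rw [smul_comm, hk r hr, smul_zero]⟩

variable {𝔞 : Ideal R} {M : Type*} [AddCommGroup M] [Module R M]

lemma Submodule.idealPowerTorsion_idealPowerTorsion_eq_top :
    Submodule.idealPowerTorsion 𝔞 (Submodule.idealPowerTorsion 𝔞 M) = ⊤ := by
  rw [eq_top_iff]
  rintro ⟨m, k, hk⟩ -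
  exact ⟨k, fun r hr => Subtype.ext (hk r hr)⟩

lemma Submodule.idealPowerTorsion_eq_top_of_surjective {M' : Type*} [AddCommGroup M']
    [Module R M'] (h : Submodule.idealPowerTorsion 𝔞 M = ⊤) (f : M →ₗ[R] M')
    (hf : Function.Surjective f) : Submodule.idealPowerTorsion 𝔞 M' = ⊤ := by
  rw [eq_top_iff] at h ⊢
  intro y _
  obtain ⟨m, rfl⟩ := hf y
  obtain ⟨k, hk⟩ := h (x := m) trivial
  exact ⟨k, fun r hr => by rw [← map_smul, hk r hr, map_zero]⟩

lemma Submodule.FG.exists_pow_smul_eq_zero {L : Submodule R M} (hL : L.FG)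
    (h : L ≤ Submodule.idealPowerTorsion 𝔞 M) :
    ∃ k : ℕ, ∀ r ∈ 𝔞 ^ k, ∀ m ∈ L, r • m = 0 := by
  induction L, hL using Submodule.fg_induction with
  | singleton x =>
    obtain ⟨k, hk⟩ := h (Submodule.mem_span_singleton_self x)
    refine ⟨k, fun r hr m hm => ?_⟩
    obtain ⟨c, rfl⟩ := Submodule.mem_span_singleton.1 hm
    rw [smul_comm, hk r hr, smul_zero]
  | sup L₁ L₂ _ _ h₁ h₂ =>
    obtain ⟨k, hk⟩ := h₁ (le_sup_left.trans h)
    obtain ⟨l, hl⟩ := h₂ (le_sup_right.trans h)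
    refine ⟨k + l, fun r hr m hm => ?_⟩
    obtain ⟨x, hx, y, hy, rfl⟩ := Submodule.mem_sup.1 hm
    rw [smul_add, hk r (Ideal.pow_le_pow_right (Nat.le_add_right k l) hr) x hx,
      hl r (Ideal.pow_le_pow_right (Nat.le_add_left l k) hr) y hy, add_zero]

lemma Submodule.eq_zero_of_smul_eq_zero_quotient_idealPowerTorsion (h𝔞 : 𝔞.FG)
    (y : M ⧸ Submodule.idealPowerTorsion 𝔞 M) (hy : ∀ r ∈ 𝔞, r • y = 0) : y = 0 := by
  obtain ⟨m, rfl⟩ := Submodule.Quotient.mk_surjective _ y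
  have hle : Submodule.map (LinearMap.toSpanSingleton R M m) 𝔞 ≤
      Submodule.idealPowerTorsion 𝔞 M := by
    rintro _ ⟨r, hr, rfl⟩
    exact (Submodule.Quotient.mk_eq_zero _).1 (hy r hr)
  obtain ⟨k, hk⟩ := Submodule.FG.exists_pow_smul_eq_zero (Submodule.FG.map _ h𝔞) hle
  rw [Submodule.Quotient.mk_eq_zero]
  refine ⟨k + 1, fun r hr => ?_⟩
  rw [pow_succ] at hr
  induction hr using Submodule.mul_induction_on' with
  | mem_mul_mem a ha b hb =>
    rw [mul_smul]
    exact hk a ha _ ⟨b, hb, rfl⟩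
  | add x _ y _ hx hy => rw [add_smul, hx, hy, add_zero]

variable (𝔞) in
/-- Over a Noetherian ring, the `𝔞`-power torsion of an injective module is injective. -/
lemma Module.Baer.idealPowerTorsion [IsNoetherianRing R] (hM : Module.Baer R M) :
    Module.Baer R (Submodule.idealPowerTorsion 𝔞 M) := by
  intro J g
  let g₁ : J →ₗ[R] M := (Submodule.idealPowerTorsion 𝔞 M).subtype ∘ₗ g
  obtain ⟨k, hk⟩ := Submodule.FG.exists_pow_smul_eq_zero (𝔞 := 𝔞)
    (L := LinearMap.range g₁) (by
      rw [LinearMap.range_eq_map]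
      exact Submodule.FG.map _ (IsNoetherian.noetherian _)) (by
      rintro _ ⟨j, rfl⟩
      exact (g j).2)
  obtain ⟨c, hc⟩ := Ideal.exists_pow_inf_eq_pow_smul 𝔞 (M := R) J
  have hg (j : J) (hj : (j : R) ∈ 𝔞 ^ (c + k)) : g₁ j = 0 := by
    have h₁ : (j : R) ∈ 𝔞 ^ k • J := by
      have h₂ : (j : R) ∈ 𝔞 ^ (c + k) • (⊤ : Submodule R R) ⊓ J := ⟨by simpa using hj, j.2⟩
      rw [hc _ (Nat.le_add_right c k), Nat.add_sub_cancel_left] at h₂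
      exact Submodule.smul_mono le_rfl inf_le_right h₂
    have h₃ : 𝔞 ^ k • J ≤ (LinearMap.ker g₁).map J.subtype := by
      rw [Submodule.smul_le]
      intro r hr x hx
      refine ⟨r • ⟨x, hx⟩, ?_, rfl⟩
      change g₁ _ = 0
      rw [map_smul]
      exact hk r hr _ ⟨_, rfl⟩
    obtain ⟨j', hj', h⟩ := h₃ h₁
    rw [← Subtype.ext h]
    exact hj'
  let φ : R →ₗ.[R] M := LinearPMap.sup ⟨J, g₁⟩ ⟨𝔞 ^ (c + k), 0⟩ (by
    rintro x ⟨y, hy⟩ h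
    exact hg x (by rw [h]; exact hy))
  obtain ⟨ψ, hψ⟩ := hM φ.domain φ.toFun
  have hψ₁ (j : J) : ψ j = g₁ j := by
    refine (hψ j (le_sup_left (a := J) j.2)).trans ?_
    exact ((LinearPMap.left_le_sup (⟨J, g₁⟩ : R →ₗ.[R] M) ⟨𝔞 ^ (c + k), 0⟩ _).2 rfl).symm
  have hψ₂ (r : R) (hr : r ∈ 𝔞 ^ (c + k)) : ψ r = 0 := by
    refine (hψ r (le_sup_right (b := 𝔞 ^ (c + k)) hr)).trans ?_
    exact ((LinearPMap.right_le_sup (⟨J, g₁⟩ : R →ₗ.[R] M) ⟨𝔞 ^ (c + k), 0⟩ _).2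
      (x := ⟨r, hr⟩) rfl).symm
  refine ⟨ψ.codRestrict _ fun s => ⟨c + k, fun r hr => ?_⟩, fun x hx => Subtype.ext ?_⟩
  · rw [← map_smul]
    exact hψ₂ _ (Ideal.mul_mem_right _ _ hr)
  · exact hψ₁ ⟨x, hx⟩

end IdealPowerTorsion

section Vanishing

open Limits

namespace localCohomology

variable {R : Type u} [CommRing R] (𝔞 : Ideal R)

lemma exists_coconeObj_ι_app_eq {i : ℕ} {M : ModuleCat.{u} R}
    (y : (localCohomology 𝔞 i).obj M) :
    ∃ j, ∃ z : (diagram (idealPowersDiagram 𝔞) i ⋙ (evaluation _ _).obj M).obj j,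
      (coconeObj 𝔞 i M).ι.app j z = y := by
  have : PreservesFilteredColimitsOfSize.{0, 0} (forget (ModuleCat.{u} R)) :=
    preservesFilteredColimitsOfSize_shrink.{0, u, 0, u} _
  exact Concrete.isColimit_exists_rep _ (isColimitCoconeObj 𝔞 i M) y

lemma map_coconeObj_ι_app (i : ℕ) {M N : ModuleCat.{u} R} (f : M ⟶ N) (j)
    (z : (diagram (idealPowersDiagram 𝔞) i ⋙ (evaluation _ _).obj M).obj j) :
    (localCohomology 𝔞 i).map f ((coconeObj 𝔞 i M).ι.app j z) =
      (coconeObj 𝔞 i N).ι.app j ((diagramMap 𝔞 i f).app j z) :=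
  ConcreteCategory.congr_hom (coconeObj_ι_map 𝔞 i f j) z

lemma map_smul_id (i : ℕ) (M : ModuleCat.{u} R) (x : R) (y : (localCohomology 𝔞 i).obj M) :
    (localCohomology 𝔞 i).map (x • 𝟙 M) y = x • y := by
  obtain ⟨j, z, rfl⟩ := exists_coconeObj_ι_app_eq 𝔞 y
  exact (map_coconeObj_ι_app 𝔞 i (x • 𝟙 M) j z).trans ((congrArg ((coconeObj 𝔞 i M).ι.app j)
    (Ext_map_smul_id i _ M x z)).trans (((coconeObj 𝔞 i M).ι.app j).hom.map_smul x z))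

lemma subsingleton_of_injective (E : ModuleCat.{u} R) [Injective E] (i : ℕ) :
    Subsingleton ((localCohomology 𝔞 (i + 1)).obj E) := by
  refine subsingleton_of_forall_eq 0 fun y => ?_
  obtain ⟨j, z, rfl⟩ := exists_coconeObj_ι_app_eq 𝔞 y
  have := subsingleton_Ext_succ_of_injective
    ((ringModIdeals (idealPowersDiagram 𝔞)).op.obj j) E i
  have hz : z = 0 := this.elim _ _
  rw [hz]
  exact map_zero ((coconeObj 𝔞 (i + 1) E).ι.app j).hom

lemma map_zero_surjective {E C : ModuleCat.{u} R} (g : E ⟶ C) (hg : Function.Surjective g)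
    (hE : Submodule.idealPowerTorsion 𝔞 E = ⊤) :
    Function.Surjective ((localCohomology 𝔞 0).map g) := by
  intro y
  obtain ⟨⟨⟨k⟩⟩, z, rfl⟩ := exists_coconeObj_ι_app_eq 𝔞 y
  obtain ⟨(φ : ModuleCat.of R (R ⧸ 𝔞 ^ k) ⟶ C), rfl⟩ := extZeroOfHom_surjective _ _ z
  obtain ⟨e, he⟩ := hg (φ (Submodule.Quotient.mk 1))
  obtain ⟨l, hl⟩ := hE.ge (x := e) trivial
  let a : (op (op k) : (ℕᵒᵖ)ᵒᵖ) ⟶ op (op (k + l)) := (homOfLE (Nat.le_add_right k l)).op.op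
  let ψ : ModuleCat.of R (R ⧸ 𝔞 ^ (k + l)) ⟶ E :=
    ModuleCat.ofHom ((𝔞 ^ (k + l)).liftQ (LinearMap.toSpanSingleton R E e) fun r hr =>
      hl r (Ideal.pow_le_pow_right (Nat.le_add_left l k) hr))
  refine ⟨(coconeObj 𝔞 0 E).ι.app (op (op (k + l))) (extZeroOfHom _ _ ψ), ?_⟩
  refine (map_coconeObj_ι_app 𝔞 0 g _ _).trans (Eq.trans ?_
    (ConcreteCategory.congr_hom ((coconeObj 𝔞 0 C).w a) _))
  refine congrArg ((coconeObj 𝔞 0 C).ι.app (op (op (k + l)))) ?_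
  refine (Ext_zero_map_extZeroOfHom _ ψ g).trans (Eq.trans ?_
    (Ext_zero_map_left_extZeroOfHom ((ringModIdeals (idealPowersDiagram 𝔞)).op.map a) C φ).symm)
  congr 1
  apply ModuleCat.hom_ext
  apply Submodule.linearMap_qext
  apply LinearMap.ext_ring
  change g ((1 : R) • e) = φ (Submodule.Quotient.mk 1)
  rw [one_smul, he]

variable [IsNoetherianRing R]

lemma subsingleton_of_idealPowerTorsion_eq_top (i : ℕ) (M : Type u) [AddCommGroup M]
    [Module R M] (hM : Submodule.idealPowerTorsion 𝔞 M = ⊤) :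
    Subsingleton ((localCohomology 𝔞 (i + 1)).obj (ModuleCat.of R M)) := by
  induction i using Nat.strong_induction_on generalizing M with
  | _ i ih =>
    let I := Injective.under (ModuleCat.of R M)
    let ι : M →ₗ[R] I := (Injective.ι (ModuleCat.of R M)).hom
    have hι : Function.Injective ι := (ModuleCat.mono_iff_injective _).1 inferInstance
    have : Module.Injective R I := by
      have : Injective (ModuleCat.of R I) := inferInstanceAs (Injective I)
      exact Module.injective_module_of_injective_object R I
    let E := Submodule.idealPowerTorsion 𝔞 I
    have : Module.Injective R E :=
      (Module.Baer.idealPowerTorsion 𝔞 (Module.Baer.of_injective inferInstance)).injective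
    have : Injective (ModuleCat.of R E) := Module.injective_object_of_injective_module R E
    let f : M →ₗ[R] E := ι.codRestrict E fun m => by
      obtain ⟨k, hk⟩ := hM.ge (x := m) trivial
      exact ⟨k, fun r hr => by rw [← map_smul, hk r hr, map_zero]⟩
    have hS := ModuleCat.shortComplex_shortExact
      (ModuleCat.shortComplexOfCompEqZero f (LinearMap.range f).mkQ (LinearMap.range_mkQ_comp f))
      (LinearMap.exact_map_mkQ_range f) (fun x y h => hι (congrArg Subtype.val h))
      (Submodule.mkQ_surjective _)
    have hE : Submodule.idealPowerTorsion 𝔞 E = ⊤ :=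
      Submodule.idealPowerTorsion_idealPowerTorsion_eq_top
    have hδ : Function.Surjective (δ 𝔞 hS i) := by
      intro y
      refine (δ_map_exact 𝔞 hS i y).1 ?_
      exact (subsingleton_of_injective 𝔞 (ModuleCat.of R E) i).elim _ _
    refine subsingleton_of_forall_eq 0 fun y => ?_
    obtain ⟨z, rfl⟩ := hδ y
    have hz : z ∈ Set.range
        ((localCohomology 𝔞 i).map (ModuleCat.ofHom (LinearMap.range f).mkQ)) := by
      rcases i with _ | i
      · exact map_zero_surjective 𝔞 (E := ModuleCat.of R E)
          (ModuleCat.ofHom (LinearMap.range f).mkQ) (Submodule.mkQ_surjective _) hE z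
      · have := ih i (Nat.lt_succ_self i) (E ⧸ LinearMap.range f)
          (Submodule.idealPowerTorsion_eq_top_of_surjective hE _ (Submodule.mkQ_surjective _))
        exact ⟨0, this.elim _ _⟩
    exact (map_δ_exact 𝔞 hS i z).2 hz

end localCohomology

end Vanishing

section Main

variable {R : Type u} [CommRing R]

lemma finite_associatedPrimes_quotient_of_surjective {N Q : Type*} [AddCommGroup N] [Module R N]
    [AddCommGroup Q] [Module R Q]
    (h : ∀ N' : Submodule R N, (associatedPrimes R (N ⧸ N')).Finite) (f : N →ₗ[R] Q)
    (hf : Function.Surjective f) (Q' : Submodule R Q) : (associatedPrimes R (Q ⧸ Q')).Finite := by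
  have e := (Q'.mkQ ∘ₗ f).quotKerEquivOfSurjective (Q'.mkQ_surjective.comp hf)
  rw [← LinearEquiv.AssociatedPrimes.eq e]
  exact h _

namespace localCohomology

variable [IsNoetherianRing R] (𝔞 : Ideal R)

lemma map_mkQ_idealPowerTorsion_bijective (N : Type u) [AddCommGroup N] [Module R N] (i : ℕ) :
    Function.Bijective ((localCohomology 𝔞 (i + 1)).map
      (ModuleCat.ofHom (Submodule.idealPowerTorsion 𝔞 N).mkQ)) := by
  let Γ := Submodule.idealPowerTorsion 𝔞 N
  have hS := ModuleCat.shortComplex_shortExact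
    (ModuleCat.shortComplexOfCompEqZero Γ.subtype Γ.mkQ (by ext; simp))
    (LinearMap.exact_subtype_mkQ Γ) Γ.injective_subtype Γ.mkQ_surjective
  have h (i) : Subsingleton ((localCohomology 𝔞 (i + 1)).obj (ModuleCat.of R Γ)) :=
    subsingleton_of_idealPowerTorsion_eq_top 𝔞 i Γ
      Submodule.idealPowerTorsion_idealPowerTorsion_eq_top
  constructor
  · refine (injective_iff_map_eq_zero ((localCohomology 𝔞 (i + 1)).map
      (ModuleCat.ofHom Γ.mkQ)).hom).2 fun y hy => ?_
    obtain ⟨z, rfl⟩ := (map_exact 𝔞 hS (i + 1) y).1 hy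
    rw [(h i).elim z 0]
    exact map_zero ((localCohomology 𝔞 (i + 1)).map (ModuleCat.ofHom Γ.subtype)).hom
  · exact fun y => (map_δ_exact 𝔞 hS (i + 1) y).1 ((h (i + 1)).elim _ _)

lemma isArtinian_quotient_of_supportDim_lt (n : ℕ) (N : Type u) [AddCommGroup N] [Module R N]
    (h_wl : ∀ N' : Submodule R N, (associatedPrimes R (N ⧸ N')).Finite)
    (h_dim : Module.supportDim R N < n) (t : ℕ) (h_pos : 0 < t)
    (h_art : ∀ i, t < i → IsArtinian R ((localCohomology 𝔞 i).obj (ModuleCat.of R N))) :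
    IsArtinian R
      (((localCohomology 𝔞 t).obj (ModuleCat.of R N)) ⧸
        (𝔞 • ⊤ : Submodule R ((localCohomology 𝔞 t).obj (ModuleCat.of R N)))) := by
  obtain ⟨t, rfl⟩ := Nat.exists_eq_succ_of_ne_zero h_pos.ne'
  induction n generalizing N with
  | zero =>
    have hN : Subsingleton N := by
      rw [← Module.supportDim_eq_bot_iff_subsingleton R]
      exact WithBot.lt_coe_bot.1 h_dim
    have := subsingleton_of_idealPowerTorsion_eq_top 𝔞 t N
      (Subsingleton.elim _ _)
    infer_instance
  | succ n ih =>
    let Γ := Submodule.idealPowerTorsion 𝔞 N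
    have hΓ := map_mkQ_idealPowerTorsion_bijective 𝔞 N
    have h_art' (i) (hi : t < i) :
        IsArtinian R ((localCohomology 𝔞 (i + 1)).obj (ModuleCat.of R (N ⧸ Γ))) :=
      have := h_art (i + 1) (Nat.succ_lt_succ hi)
      isArtinian_of_surjective _ ((localCohomology 𝔞 (i + 1)).map (ModuleCat.ofHom Γ.mkQ)).hom
        (hΓ i).2
    obtain ⟨x, hx𝔞, hx⟩ := exists_mem_ideal_isSMulRegular (h_wl Γ)
      (Submodule.eq_zero_of_smul_eq_zero_quotient_idealPowerTorsion (𝔞 := 𝔞)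
        (IsNoetherian.noetherian 𝔞))
    have hS := IsSMulRegular.smulShortComplex_shortExact (M := ModuleCat.of R (N ⧸ Γ)) hx
    let Q := QuotSMulTop x (N ⧸ Γ)
    let π : (N ⧸ Γ) →ₗ[R] Q := Submodule.mkQ _
    have hπ : Function.Surjective π := Submodule.mkQ_surjective _
    have hQ := ih Q
      (finite_associatedPrimes_quotient_of_surjective h_wl (π ∘ₗ Γ.mkQ)
        (hπ.comp Γ.mkQ_surjective))
      (by
        have h₁ := supportDim_add_one_le_of_isSMulRegular π hπ hx fun y => by
          obtain ⟨m, rfl⟩ := hπ y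
          exact (Submodule.Quotient.mk_eq_zero _).2 ⟨m, trivial, rfl⟩
        have h₂ := Module.supportDim_le_of_surjective Γ.mkQ Γ.mkQ_surjective
        by_contra! h₃
        have h₄ := ((add_le_add_left h₃ 1).trans (h₁.trans h₂)).trans_lt h_dim
        exact h₄.ne (by norm_cast))
      (fun i hi => by
        obtain ⟨i, rfl⟩ := Nat.exists_eq_succ_of_ne_zero (Nat.ne_zero_of_lt hi)
        have : IsArtinian R ((localCohomology 𝔞 (i + 1)).obj
            (ModuleCat.smulShortComplex (ModuleCat.of R (N ⧸ Γ)) x).X₂) :=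
          h_art' i (Nat.lt_of_succ_lt_succ hi)
        have : IsArtinian R ((localCohomology 𝔞 (i + 1 + 1)).obj
            (ModuleCat.smulShortComplex (ModuleCat.of R (N ⧸ Γ)) x).X₁) :=
          h_art' (i + 1) (Nat.lt_of_succ_lt hi)
        exact isArtinian_of_range_eq_ker _ _
          (LinearMap.exact_iff.1 (map_δ_exact 𝔞 hS (i + 1))).symm)
    have hN : IsArtinian R (((localCohomology 𝔞 (t + 1)).obj (ModuleCat.of R (N ⧸ Γ))) ⧸
        (𝔞 • ⊤ : Submodule R ((localCohomology 𝔞 (t + 1)).obj (ModuleCat.of R (N ⧸ Γ))))) := by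
      have : IsArtinian R ((localCohomology 𝔞 (t + 1 + 1)).obj
          (ModuleCat.smulShortComplex (ModuleCat.of R (N ⧸ Γ)) x).X₁) :=
        h_art' (t + 1) (Nat.lt_succ_self t)
      refine isArtinian_quotient_ideal_smul_top_of_exact (IsNoetherian.noetherian 𝔞)
        ((localCohomology 𝔞 (t + 1)).map (ModuleCat.ofHom π)).hom (δ 𝔞 hS (t + 1)).hom
        (map_δ_exact 𝔞 hS (t + 1)) ?_
      intro y hy
      obtain ⟨z, rfl⟩ := (map_exact 𝔞 hS (t + 1) y).1 hy
      exact (map_smul_id 𝔞 (t + 1) (ModuleCat.of R (N ⧸ Γ)) x z).symm ▸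
        Submodule.smul_mem_smul hx𝔞 Submodule.mem_top
    refine isArtinian_quotient_ideal_smul_top_of_exact (IsNoetherian.noetherian 𝔞)
      (K := PUnit.{u + 1})
      ((localCohomology 𝔞 (t + 1)).map (ModuleCat.ofHom Γ.mkQ)).hom 0
      (fun y => ⟨fun _ => (hΓ t).2 y, fun _ => rfl⟩) ?_
    rw [LinearMap.ker_eq_bot.2 (hΓ t).1]
    exact bot_le

end localCohomology

end Main

theorem quotient_of_top_localCohomology_artinian
    {R : Type u} [CommRing R] [IsNoetherianRing R]
    (𝔞 : Ideal R) (N : Type u) [AddCommGroup N] [Module R N]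
    (h_wl : ∀ N' : Submodule R N, (associatedPrimes R (N ⧸ N')).Finite)
    (h_dim : Order.krullDim ↥(Module.support R N) ≠ ⊤)
    (t : ℕ) (h_pos : 0 < t)
    (h_art : ∀ i, t < i → IsArtinian R ((localCohomology 𝔞 i).obj (ModuleCat.of R N))) :
    IsArtinian R
      (((localCohomology 𝔞 t).obj (ModuleCat.of R N)) ⧸
        (𝔞 • ⊤ : Submodule R ((localCohomology 𝔞 t).obj (ModuleCat.of R N)))) := by
  obtain ⟨n, hn⟩ : ∃ n : ℕ, Module.supportDim R N < n := by
    change Module.supportDim R N ≠ ⊤ at h_dim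
    generalize Module.supportDim R N = d at h_dim ⊢
    induction d with
    | bot => exact ⟨0, WithBot.bot_lt_coe _⟩
    | coe d =>
      induction d with
      | top => exact absurd rfl h_dim
      | coe m => exact ⟨m + 1, by exact_mod_cast Nat.lt_succ_self m⟩
  exact localCohomology.isArtinian_quotient_of_supportDim_lt 𝔞 n N h_wl hn t h_pos h_art
end

section
/- Let R be a commutative Noetherian ring, 𝔞 an ideal of R, and N a weakly Laskerian R-module of finite dimension. Suppose q is a positive integer such that H^q_𝔞(N) is not Artinian while H^i_𝔞(N) is Artinian for all i > q (i.e. q = q_𝔞(N) > 0). Then H^q_𝔞(N) is not finitely generated. -/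
/-!
STATEMENT 8: Let R be a commutative Noetherian ring, 𝔞 an ideal of R, and N a weakly Laskerian
R-module of finite dimension. Suppose q is a positive integer such that H^q_𝔞(N) is not
Artinian while H^i_𝔞(N) is Artinian for all i > q (i.e. q = q_𝔞(N) > 0). Then H^q_𝔞(N) is not
finitely generated.
-/

open CategoryTheory Opposite

universe u

section
open Limits

namespace CategoryTheory.Abelian.LeftResolution

variable {A C : Type*} [Category* C] [Category* A] {ι : C ⥤ A} (Λ : LeftResolution ι)
  [ι.Full] [ι.Faithful] [Preadditive C] [Abelian A]

/-- The augmentation from the degree zero term of the resolution. -/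
noncomputable def augmentation (X : A) : ι.obj ((Λ.chainComplex X).X 0) ⟶ X :=
  ι.map (Λ.chainComplexXZeroIso X).hom ≫ Λ.π.app X

instance (X : A) : Epi (Λ.augmentation X) := epi_comp _ _

lemma augmentation_naturality {X Y : A} (f : X ⟶ Y) :
    ι.map ((Λ.chainComplexMap f).f 0) ≫ Λ.augmentation Y = Λ.augmentation X ≫ f := by
  rw [chainComplexMap_f_0, augmentation, augmentation, ← ι.map_comp_assoc, Category.assoc,
    Category.assoc, Category.assoc, Iso.inv_hom_id, Category.comp_id, ι.map_comp, Category.assoc,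
    π_naturality]

lemma map_d_comp_augmentation (X : A) :
    ι.map ((Λ.chainComplex X).d 1 0) ≫ Λ.augmentation X = 0 := by
  rw [map_chainComplex_d_1_0]
  simp [augmentation, ← ι.map_comp_assoc]

lemma exact_augmentation (X : A) :
    (ShortComplex.mk _ _ (Λ.map_d_comp_augmentation X)).Exact := by
  let S := ShortComplex.mk _ _ (Λ.map_d_comp_augmentation X)
  let T := ShortComplex.mk (Λ.π.app (kernel (Λ.π.app X)) ≫ kernel.ι _) (Λ.π.app X) (by simp)
  let e : S ≅ T := ShortComplex.isoMk (ι.mapIso (Λ.chainComplexXOneIso X))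
    (ι.mapIso (Λ.chainComplexXZeroIso X)) (Iso.refl _)
    (by simp [S, T, map_chainComplex_d_1_0, ← ι.map_comp]) (by simp [S, T, augmentation])
  refine (ShortComplex.exact_iff_of_iso e).2 ?_
  rw [ShortComplex.exact_iff_epi_kernel_lift]
  have : kernel.lift T.g T.f T.zero = Λ.π.app _ := by
    rw [← cancel_mono (kernel.ι _), kernel.lift_ι]
  rw [this]
  infer_instance

variable [ι.Additive]

/-- The functorial resolution. -/
noncomputable abbrev resolutionFunctor : A ⥤ ChainComplex A ℕ :=
  Λ.chainComplexFunctor ⋙ ι.mapHomologicalComplex _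

/-- The resolution as a projective resolution, when `ι` takes projective values. -/
noncomputable def toProjectiveResolution (X : A) (h : ∀ Y, Projective (ι.obj Y)) :
    ProjectiveResolution X where
  complex := Λ.resolutionFunctor.obj X
  projective i := h _
  π := (ChainComplex.toSingle₀Equiv _ _).symm ⟨Λ.augmentation X, Λ.map_d_comp_augmentation X⟩
  quasiIso := ⟨fun n => by
    cases n
    · rw [ChainComplex.quasiIsoAt₀_iff, ShortComplex.quasiIso_iff_of_zeros']
      · refine (ShortComplex.exact_and_epi_g_iff_of_iso ?_).2
          ⟨Λ.exact_augmentation X, inferInstanceAs (Epi (Λ.augmentation X))⟩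
        exact ShortComplex.isoMk (Iso.refl _) (Iso.refl _) (Iso.refl _)
          ((Category.id_comp _).trans (Category.comp_id _).symm)
          ((Category.id_comp _).trans
            ((Category.comp_id (((ChainComplex.toSingle₀Equiv (Λ.resolutionFunctor.obj X) X).symm
              ⟨Λ.augmentation X, Λ.map_d_comp_augmentation X⟩).f 0)).trans
            (ChainComplex.toSingle₀Equiv_symm_apply_f_zero (C := Λ.resolutionFunctor.obj X)
              (Λ.augmentation X) (Λ.map_d_comp_augmentation X))).symm)
      · exact (Λ.resolutionFunctor.obj X).shape 0 0 (by simp)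
      all_goals rfl
    · rw [quasiIsoAt_iff_exactAt']
      · apply Λ.exactAt_map_chainComplex_succ
      · apply ChainComplex.exactAt_succ_single_obj⟩

end CategoryTheory.Abelian.LeftResolution

end

section
open Limits

namespace HomologicalComplex

variable {J C ι' : Type*} [Category* J] [Category* C] [Abelian C] {c : ComplexShape ι'}
  [HasColimitsOfShape J C]

/-- For a functor `K` to complexes, the short complex of functors computing the homology of `K`
in degree `i`. -/
noncomputable def functorShortComplex (K : J ⥤ HomologicalComplex C c) (i : ι') :
    ShortComplex (J ⥤ C) :=
  (ShortComplex.functorEquivalence J C).inverse.obj (K ⋙ shortComplexFunctor C c i)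

/-- The homology of `functorShortComplex K i` is computed pointwise. -/
noncomputable def functorShortComplexHomologyIso (K : J ⥤ HomologicalComplex C c) (i : ι') :
    (functorShortComplex K i).homology ≅ K ⋙ homologyFunctor C c i :=
  NatIso.ofComponents
    (fun j => ((functorShortComplex K i).mapHomologyIso ((evaluation J C).obj j)).symm)
    (fun {j j'} f => by
      have h := NatTrans.app_homology ((evaluation J C).map f) (functorShortComplex K i)
      exact (Iso.comp_inv_eq _).2 (h.trans (Category.assoc _ _ _).symm))

/-- The colimit of `functorShortComplex K i` is the short complex of the colimit of `K`. -/
noncomputable def mapColimIso (K : J ⥤ HomologicalComplex C c) (i : ι') :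
    (functorShortComplex K i).map (colim : (J ⥤ C) ⥤ C) ≅ (colimit K).sc i :=
  ShortComplex.isoMk (preservesColimitIso (eval C c (c.prev i)) K).symm
    (preservesColimitIso (eval C c i) K).symm
    (preservesColimitIso (eval C c (c.next i)) K).symm
    (colimit.hom_ext fun j => by
      have h₁ := ι_preservesColimitIso_inv (eval C c (c.prev i)) K j
      have h₂ := ι_preservesColimitIso_inv (eval C c i) K j
      have h₃ := ι_colimMap (functorShortComplex K i).f j
      have h₄ := (colimit.ι K j).comm (c.prev i) i
      refine (Category.assoc _ _ _).symm.trans ((congrArg (· ≫ _) h₁).trans (h₄.trans ?_))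
      refine Eq.trans ?_ (Category.assoc _ _ _)
      refine Eq.trans ?_ (congrArg (· ≫ _) h₃.symm)
      refine Eq.trans ?_ (Category.assoc _ _ _).symm
      exact congrArg (_ ≫ ·) h₂.symm)
    (colimit.hom_ext fun j => by
      have h₁ := ι_preservesColimitIso_inv (eval C c i) K j
      have h₂ := ι_preservesColimitIso_inv (eval C c (c.next i)) K j
      have h₃ := ι_colimMap (functorShortComplex K i).g j
      have h₄ := (colimit.ι K j).comm i (c.next i)
      refine (Category.assoc _ _ _).symm.trans ((congrArg (· ≫ _) h₁).trans (h₄.trans ?_))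
      refine Eq.trans ?_ (Category.assoc _ _ _)
      refine Eq.trans ?_ (congrArg (· ≫ _) h₃.symm)
      refine Eq.trans ?_ (Category.assoc _ _ _).symm
      exact congrArg (_ ≫ ·) h₂.symm)

/-- The structure maps of colimits, as a natural transformation. -/
noncomputable def evaluationToColim (j : J) : (evaluation J C).obj j ⟶ colim where
  app F := colimit.ι F j

lemma mapNatTrans_comp_mapColimIso (K : J ⥤ HomologicalComplex C c) (i : ι') (j : J) :
    (functorShortComplex K i).mapNatTrans (evaluationToColim j) ≫ (mapColimIso K i).hom =
      (shortComplexFunctor C c i).map (colimit.ι K j) := by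
  ext
  · exact ι_preservesColimitIso_inv (eval C c (c.prev i)) K j
  · exact ι_preservesColimitIso_inv (eval C c i) K j
  · exact ι_preservesColimitIso_inv (eval C c (c.next i)) K j

variable [HasExactColimitsOfShape J C]

/-- Homology commutes with colimits of shape `J` when these are exact. -/
noncomputable def isColimitMapCoconeHomologyFunctor (K : J ⥤ HomologicalComplex C c) (i : ι') :
    IsColimit ((homologyFunctor C c i).mapCocone (colimit.cocone K)) := by
  refine IsColimit.ofIsoColimit ((IsColimit.precomposeHomEquiv
    (functorShortComplexHomologyIso K i).symm _).symm
      (colimit.isColimit (functorShortComplex K i).homology)) ?_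
  refine Cocone.ext (((functorShortComplex K i).mapHomologyIso colim).symm ≪≫
      ShortComplex.homologyMapIso (mapColimIso K i)) fun j => ?_
  have h := NatTrans.app_homology (evaluationToColim j) (functorShortComplex K i)
  have h' : ShortComplex.homologyMap
        ((functorShortComplex K i).mapNatTrans (evaluationToColim j)) ≫
      ShortComplex.homologyMap (mapColimIso K i).hom = homologyMap (colimit.ι K j) i := by
    refine (ShortComplex.homologyMap_comp _ _).symm.trans ?_
    rw [mapNatTrans_comp_mapColimIso]
    rfl
  refine Eq.trans ?_ h'
  have h'' : ((functorShortComplex K i).mapHomologyIso ((evaluation J C).obj j)).hom ≫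
      colimit.ι (functorShortComplex K i).homology j =
    ShortComplex.homologyMap ((functorShortComplex K i).mapNatTrans (evaluationToColim j)) ≫
        ((functorShortComplex K i).mapHomologyIso colim).hom :=
    (Iso.eq_inv_comp _).1 h
  refine (congrArg (· ≫ _) h'').trans ?_
  refine (Category.assoc _ _ _).trans (congrArg (_ ≫ ·) ?_)
  exact Iso.hom_inv_id_assoc _ _

instance (i : ι') : PreservesColimitsOfShape J (homologyFunctor C c i) where
  preservesColimit {K} := preservesColimit_of_preserves_colimit_cocone (colimit.isColimit K)
    (isColimitMapCoconeHomologyFunctor K i)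

end HomologicalComplex

end

section
open Limits

namespace HomologicalComplex

lemma homologyUnop_hom_naturality {V ι' : Type*} [Category* V] [Abelian V]
    {c : ComplexShape ι'} {A B : HomologicalComplex Vᵒᵖ c} (ψ : A ⟶ B) (i : ι') :
    homologyMap ((unopFunctor V c).map ψ.op) i ≫ (A.homologyUnop i).hom =
      (B.homologyUnop i).hom ≫ (homologyMap ψ i).unop := by
  have h := homologyOp_hom_naturality ((unopFunctor V c).map ψ.op) i
  exact (congrArg Quiver.Hom.unop h).symm

end HomologicalComplex

namespace ChainComplex

variable (R : Type*) [Ring R] {C : Type*} [Category* C] [Abelian C] [Linear R C]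

/-- Precomposition with a morphism of chain complexes. -/
noncomputable def linearYonedaMap {K L : ChainComplex C ℕ} (φ : K ⟶ L) (Y : C) :
    L.linearYonedaObj R Y ⟶ K.linearYonedaObj R Y :=
  (HomologicalComplex.unopFunctor _ _).map
    ((((linearYoneda R C).obj Y).rightOp.mapHomologicalComplex _).map φ).op

/-- Postcomposition with a morphism of coefficients. -/
noncomputable def linearYonedaMapRight (K : ChainComplex C ℕ) {Y Z : C} (g : Y ⟶ Z) :
    K.linearYonedaObj R Y ⟶ K.linearYonedaObj R Z where
  f i := ((linearYoneda R C).map g).app (op (K.X i))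
  comm' i j _ := (((linearYoneda R C).map g).naturality (K.d j i).op).symm

lemma linearYonedaMap_id (K : ChainComplex C ℕ) (Y : C) :
    linearYonedaMap R (𝟙 K) Y = 𝟙 _ := by
  refine (congrArg _ (congrArg Quiver.Hom.op (CategoryTheory.Functor.map_id _ _))).trans ?_
  exact CategoryTheory.Functor.map_id _ _

lemma linearYonedaMap_comp {K L M : ChainComplex C ℕ} (φ : K ⟶ L) (ψ : L ⟶ M) (Y : C) :
    linearYonedaMap R (φ ≫ ψ) Y = linearYonedaMap R ψ Y ≫ linearYonedaMap R φ Y := by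
  refine (congrArg _ (congrArg Quiver.Hom.op (CategoryTheory.Functor.map_comp _ _ _))).trans ?_
  exact CategoryTheory.Functor.map_comp _ _ _

lemma linearYonedaMap_comp_linearYonedaMapRight {K L : ChainComplex C ℕ} (φ : K ⟶ L)
    {Y Z : C} (g : Y ⟶ Z) :
    linearYonedaMap R φ Y ≫ linearYonedaMapRight R K g =
      linearYonedaMapRight R L g ≫ linearYonedaMap R φ Z := by
  ext i : 1
  exact ((linearYoneda R C).map g).naturality (φ.f i).op

/-- The cochain complex of morphisms, as a functor in both variables. -/
noncomputable def linearYonedaFunctor :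
    C ⥤ (ChainComplex C ℕ)ᵒᵖ ⥤ CochainComplex (ModuleCat R) ℕ where
  obj Y :=
    { obj K := K.unop.linearYonedaObj R Y
      map φ := linearYonedaMap R φ.unop Y
      map_id K := linearYonedaMap_id R K.unop Y
      map_comp φ ψ := linearYonedaMap_comp R ψ.unop φ.unop Y }
  map g :=
    { app K := linearYonedaMapRight R K.unop g
      naturality _ _ φ := linearYonedaMap_comp_linearYonedaMapRight R φ.unop g }
  map_id Y := by
    ext K i : 3
    exact congrArg (fun α => NatTrans.app α (op (K.unop.X i))) ((linearYoneda R C).map_id Y)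
  map_comp f g := by
    ext K i : 3
    exact congrArg (fun α => NatTrans.app α (op (K.unop.X i))) ((linearYoneda R C).map_comp f g)

end ChainComplex

namespace CategoryTheory.ProjectiveResolution

variable {R : Type*} [Ring R] {C : Type*} [Category* C] [Abelian C] [Linear R C]
  [EnoughProjectives C]

lemma _root_.CategoryTheory.comp_comp_inv_of_comm {D : Type*} [Category* D]
    {A B A' B' A'' B'' : D} {m : A ⟶ B} {p : B ⟶ B'} {q : A ⟶ A'} {h : A' ⟶ B'}
    {k : A'' ⟶ B''} {eA : A'' ≅ A'} {eB : B'' ≅ B'} (h₁ : m ≫ p = q ≫ h)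
    (h₂ : k ≫ eB.hom = eA.hom ≫ h) : m ≫ p ≫ eB.inv = (q ≫ eA.inv) ≫ k := by
  rw [reassoc_of% h₁, Category.assoc, ← cancel_mono eB.hom]
  simp [h₂]

lemma isoExt_hom_naturality {X Y : C} (f : X ⟶ Y) (P : ProjectiveResolution X)
    (Q : ProjectiveResolution Y) (φ : P.complex ⟶ Q.complex)
    (comm : φ.f 0 ≫ Q.π.f 0 = P.π.f 0 ≫ f) (n : ℕ) (Z : C) :
    ((Ext R C n).map f.op).app Z ≫ (P.isoExt n Z).hom =
      (Q.isoExt n Z).hom ≫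
        HomologicalComplex.homologyMap (ChainComplex.linearYonedaMap R φ Z) n := by
  have h₁ := isoLeftDerivedObj_inv_naturality f P Q φ comm ((linearYoneda R C).obj Z).rightOp n
  have h₂ := HomologicalComplex.homologyUnop_hom_naturality
    ((((linearYoneda R C).obj Z).rightOp.mapHomologicalComplex (ComplexShape.down ℕ)).map φ) n
  exact comp_comp_inv_of_comm (congrArg Quiver.Hom.unop h₁) h₂

end CategoryTheory.ProjectiveResolution

end

section
open Limits

instance ModuleCat.hasExactColimitsOfShape_nat {R : Type u} [Ring R] :
    HasExactColimitsOfShape ℕᵒᵖᵒᵖ (ModuleCat.{u} R) :=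
  HasExactColimitsOfShape.of_domain_equivalence (C := ModuleCat.{u} R) (J' := ℕᵒᵖᵒᵖ)
    (J := AsSmall.{u} ℕᵒᵖᵒᵖ) AsSmall.equiv.symm

namespace ModuleCat

variable (R : Type u) [Ring R]

lemma projective_of_isProjective (P : (isProjective (ModuleCat.{u} R)).FullSubcategory) :
    Projective (((isProjective (ModuleCat.{u} R)).ι).obj P) := P.property

/-- A projective resolution of a module, depending functorially on the module. -/
noncomputable abbrev functorialResolution : ModuleCat.{u} R ⥤ ChainComplex (ModuleCat.{u} R) ℕ :=
  (projectiveResolution R).resolutionFunctor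

end ModuleCat

namespace localCohomology

variable {R : Type u} [CommRing R] (𝔞 : Ideal R)

/-- The functorial resolutions of the quotients `R ⧸ 𝔞 ^ n`. -/
noncomputable def resolutionDiagram : ℕᵒᵖᵒᵖ ⥤ (ChainComplex (ModuleCat.{u} R) ℕ)ᵒᵖ :=
  (ringModIdeals (idealPowersDiagram 𝔞)).op ⋙ (ModuleCat.functorialResolution R).op

/-- A complex computing local cohomology. -/
noncomputable def complexFunctor : ModuleCat.{u} R ⥤ CochainComplex (ModuleCat.{u} R) ℕ :=
  ChainComplex.linearYonedaFunctor R ⋙ (Functor.whiskeringLeft _ _ _).obj (resolutionDiagram 𝔞) ⋙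
    colim

/-- The functorial resolution as a bundled projective resolution. -/
noncomputable abbrev _root_.ModuleCat.functorialProjectiveResolution {R : Type u} [Ring R]
    (X : ModuleCat.{u} R) : ProjectiveResolution X :=
  (ModuleCat.projectiveResolution R).toProjectiveResolution X
    (ModuleCat.projective_of_isProjective R)

lemma _root_.ModuleCat.functorialResolution_map_f_zero_comp {R : Type u} [Ring R]
    {X Y : ModuleCat.{u} R} (f : X ⟶ Y) :
    ((ModuleCat.functorialResolution R).map f).f 0 ≫
        (ModuleCat.functorialProjectiveResolution Y).π.f 0 =
      (ModuleCat.functorialProjectiveResolution X).π.f 0 ≫ f := by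
  have h := (ModuleCat.projectiveResolution R).augmentation_naturality f
  have hπ (Z : ModuleCat.{u} R) : (ModuleCat.functorialProjectiveResolution Z).π.f 0 =
      (ModuleCat.projectiveResolution R).augmentation Z :=
    ChainComplex.toSingle₀Equiv_symm_apply_f_zero
      (C := (ModuleCat.projectiveResolution R).resolutionFunctor.obj Z)
      ((ModuleCat.projectiveResolution R).augmentation Z)
      ((ModuleCat.projectiveResolution R).map_d_comp_augmentation Z)
  refine (congrArg (_ ≫ ·) (hπ Y)).trans (h.trans ?_)
  exact congrArg (· ≫ f) (hπ X).symm

/-- `Ext` computed by functorial resolutions, naturally in the first variable. -/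
noncomputable def extIso (N : ModuleCat.{u} R) (i : ℕ) :
    (Ext R (ModuleCat.{u} R) i).flip.obj N ≅ (ModuleCat.functorialResolution R).op ⋙
      (ChainComplex.linearYonedaFunctor R).obj N ⋙ HomologicalComplex.homologyFunctor _ _ i :=
  NatIso.ofComponents (fun X => (ModuleCat.functorialProjectiveResolution X.unop).isoExt i N)
    (fun {_ _} f => ProjectiveResolution.isoExt_hom_naturality f.unop
      (ModuleCat.functorialProjectiveResolution _) (ModuleCat.functorialProjectiveResolution _)
      ((ModuleCat.functorialResolution R).map f.unop)
      (ModuleCat.functorialResolution_map_f_zero_comp _) i N)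

/-- The complexes whose colimit is `(complexFunctor 𝔞).obj N`. -/
noncomputable def complexDiagram (N : ModuleCat.{u} R) :
    ℕᵒᵖᵒᵖ ⥤ CochainComplex (ModuleCat.{u} R) ℕ :=
  resolutionDiagram 𝔞 ⋙ (ChainComplex.linearYonedaFunctor R).obj N

/-- Local cohomology is the cohomology of `complexFunctor 𝔞`. -/
noncomputable def homologyIso (N : ModuleCat.{u} R) (i : ℕ) :
    (localCohomology 𝔞 i).obj N ≅
      (complexFunctor 𝔞 ⋙ HomologicalComplex.homologyFunctor _ _ i).obj N :=
  colimitObjIsoColimitCompEvaluation (diagram (idealPowersDiagram 𝔞) i) N ≪≫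
    HasColimit.isoOfNatIso
      (Functor.isoWhiskerLeft (ringModIdeals (idealPowersDiagram 𝔞)).op (extIso N i)) ≪≫
    (preservesColimitIso (HomologicalComplex.homologyFunctor _ _ i) (complexDiagram 𝔞 N)).symm

end localCohomology

end

section
open Limits

namespace CategoryTheory

lemma ShortComplex.shortExact_of_evaluation {J C : Type*} [Category* J] [Category* C] [Abelian C]
    (S : ShortComplex (J ⥤ C)) (h : ∀ j, (S.map ((evaluation J C).obj j)).ShortExact) :
    S.ShortExact where
  mono_f := by
    have (j : J) : Mono (S.f.app j) := (h j).mono_f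
    exact NatTrans.mono_of_mono_app _
  epi_g := by
    have (j : J) : Epi (S.g.app j) := (h j).epi_g
    exact NatTrans.epi_of_epi_app _
  exact := by
    rw [ShortComplex.exact_iff_isZero_homology]
    refine Functor.isZero _ fun j => ?_
    exact ((ShortComplex.exact_iff_isZero_homology _).1 (h j).exact).of_iso
      (S.mapHomologyIso ((evaluation J C).obj j)).symm

lemma ShortComplex.ShortExact.map_linearCoyoneda {C : Type*} [Category* C] [Abelian C]
    (R : Type*) [Ring R] [Linear R C] {S : ShortComplex C} (hS : S.ShortExact) (P : C)
    [hP : Projective P] : (S.map ((linearCoyoneda R C).obj (Opposite.op P))).ShortExact where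
  mono_f := by
    have := hS.mono_f
    rw [ModuleCat.mono_iff_injective]
    intro a b h
    exact (cancel_mono S.f).1 h
  epi_g := by
    have := hS.epi_g
    rw [ModuleCat.epi_iff_surjective]
    intro a
    exact ⟨Projective.factorThru a S.g, Projective.factorThru_comp a S.g⟩
  exact := by
    have := hS.mono_f
    rw [ShortComplex.moduleCat_exact_iff]
    intro a h
    exact ⟨hS.exact.lift a h, hS.exact.lift_f a h⟩

end CategoryTheory

namespace localCohomology

variable {R : Type u} [CommRing R] (𝔞 : Ideal R)

/-- The diagram of complexes whose colimit is `complexFunctor 𝔞`. -/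
noncomputable abbrev diagramFunctor :
    ModuleCat.{u} R ⥤ ℕᵒᵖᵒᵖ ⥤ CochainComplex (ModuleCat.{u} R) ℕ :=
  ChainComplex.linearYonedaFunctor R ⋙ (Functor.whiskeringLeft _ _ _).obj (resolutionDiagram 𝔞)

instance : (diagramFunctor 𝔞).Additive where
  map_add {X Y f g} := by
    refine NatTrans.ext (funext fun j => HomologicalComplex.hom_ext _ _ fun i =>
      ModuleCat.hom_ext (LinearMap.ext fun z => ?_))
    exact Preadditive.comp_add _ _ _ z f g

instance : (complexFunctor 𝔞).Additive :=
  inferInstanceAs (diagramFunctor 𝔞 ⋙ colim).Additive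

lemma shortExact_map_complexFunctor {S : ShortComplex (ModuleCat.{u} R)} (hS : S.ShortExact) :
    (S.map (complexFunctor 𝔞)).ShortExact := by
  have h : (S.map (diagramFunctor 𝔞)).ShortExact := by
    refine ShortComplex.shortExact_of_evaluation _ fun j =>
      HomologicalComplex.shortExact_of_degreewise_shortExact _ fun i => ?_
    exact hS.map_linearCoyoneda R _ (hP := (ModuleCat.functorialProjectiveResolution
      (((ringModIdeals (idealPowersDiagram 𝔞)).op.obj j).unop)).projective i)
  exact h.map_of_exact colim

end localCohomology

end

section
open Limits

namespace CategoryTheory.ProjectiveResolution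

variable (R : Type*) [Ring R] {C : Type*} [Category* C] [Abelian C] [Linear R C]

lemma exactAt_linearYonedaObj_of_injective {X : C} (P : ProjectiveResolution X) (J : C)
    [Injective J] (n : ℕ) : (P.complex.linearYonedaObj R J).ExactAt (n + 1) := by
  rw [HomologicalComplex.exactAt_iff' _ n (n + 1) (n + 2) (by simp) (by simp),
    ShortComplex.moduleCat_exact_iff]
  intro (f : P.complex.X (n + 1) ⟶ J) (hf : P.complex.d (n + 2) (n + 1) ≫ f = 0)
  have h := (HomologicalComplex.exactAt_iff' _ (n + 2) (n + 1) n (by simp) (by simp)).1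
    (P.complex_exactAt_succ n)
  exact ⟨h.descToInjective f hf, h.comp_descToInjective f hf⟩

end CategoryTheory.ProjectiveResolution

namespace localCohomology

variable {R : Type u} [CommRing R] (𝔞 : Ideal R)

/-- Local cohomology, computed as the cohomology of a functorial complex. -/
noncomputable abbrev cohomologyFunctor (i : ℕ) : ModuleCat.{u} R ⥤ ModuleCat.{u} R :=
  complexFunctor 𝔞 ⋙ HomologicalComplex.homologyFunctor _ _ i

lemma isZero_cohomologyFunctor_obj_of_injective (J : ModuleCat.{u} R) [Injective J] (i : ℕ) :
    IsZero ((cohomologyFunctor 𝔞 (i + 1)).obj J) := by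
  refine IsZero.of_iso ?_
    (preservesColimitIso (HomologicalComplex.homologyFunctor _ _ (i + 1)) (complexDiagram 𝔞 J))
  refine (IsZero.iff_id_eq_zero _).2 (colimit.hom_ext fun j => ?_)
  refine IsZero.eq_of_src ?_ _ _
  exact ((ModuleCat.functorialProjectiveResolution
      (((ringModIdeals (idealPowersDiagram 𝔞)).op.obj j).unop)).exactAt_linearYonedaObj_of_injective
        R J i).isZero_homology

lemma cohomologyFunctor_map_smul (i : ℕ) {X Y : ModuleCat.{u} R} (r : R) (f : X ⟶ Y) :
    (cohomologyFunctor 𝔞 i).map (r • f) = r • (cohomologyFunctor 𝔞 i).map f := by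
  have h : (complexFunctor 𝔞).map (r • f) = r • (complexFunctor 𝔞).map f := by
    refine colimit.hom_ext fun j => ?_
    have h₁ := ι_colimMap ((diagramFunctor 𝔞).map f) j
    have h₂ := ι_colimMap ((diagramFunctor 𝔞).map (r • f)) j
    have h₃ : ((diagramFunctor 𝔞).map (r • f)).app j = r • ((diagramFunctor 𝔞).map f).app j := by
      refine HomologicalComplex.hom_ext _ _ fun i =>
        ModuleCat.hom_ext (LinearMap.ext fun z => ?_)
      exact Linear.comp_smul _ _ _ z r f
    refine h₂.trans ?_
    rw [h₃]
    refine (Linear.smul_comp _ _ _ _ _ _).trans ?_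
    refine Eq.trans ?_ (Linear.comp_smul _ _ _ _ _ _).symm
    exact congrArg (r • ·) h₁.symm
  refine (congrArg (HomologicalComplex.homologyFunctor _ _ i).map h).trans ?_
  exact ShortComplex.homologyMap_smul
    ((HomologicalComplex.shortComplexFunctor _ _ i).map ((complexFunctor 𝔞).map f)) r

variable {𝔞} in
lemma exact_cohomologyFunctor_map {S : ShortComplex (ModuleCat.{u} R)} (hS : S.ShortExact)
    (i : ℕ) : Function.Exact ((cohomologyFunctor 𝔞 i).map S.f) ((cohomologyFunctor 𝔞 i).map S.g) :=
  (ShortComplex.ShortExact.moduleCat_exact_iff_function_exact _).1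
    ((shortExact_map_complexFunctor 𝔞 hS).homology_exact₂ i)

variable {𝔞} in
lemma exists_connectingHom {S : ShortComplex (ModuleCat.{u} R)} (hS : S.ShortExact) (i : ℕ) :
    ∃ δ : (cohomologyFunctor 𝔞 i).obj S.X₃ →ₗ[R] (cohomologyFunctor 𝔞 (i + 1)).obj S.X₁,
      Function.Exact ((cohomologyFunctor 𝔞 i).map S.g) δ ∧
        Function.Exact δ ((cohomologyFunctor 𝔞 (i + 1)).map S.f) :=
  have h := shortExact_map_complexFunctor 𝔞 hS
  ⟨(h.δ i (i + 1) (by simp)).hom,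
    (ShortComplex.ShortExact.moduleCat_exact_iff_function_exact _).1 (h.homology_exact₃ i _ _),
    (ShortComplex.ShortExact.moduleCat_exact_iff_function_exact _).1 (h.homology_exact₁ i _ _)⟩

end localCohomology

end

section
open Limits

namespace CategoryTheory.ProjectiveResolution

variable (R : Type*) [Ring R] {C : Type*} [Category* C] [Abelian C] [Linear R C]

/-- Precomposition with the augmentation. -/
noncomputable def homToXZero {X : C} (P : ProjectiveResolution X) (N : C) :
    ModuleCat.of R (X ⟶ N) ⟶ (P.complex.linearYonedaObj R N).X 0 :=
  ModuleCat.ofHom (Linear.leftComp R N (P.π.f 0 : P.complex.X 0 ⟶ X))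

lemma homToXZero_d {X : C} (P : ProjectiveResolution X) (N : C) :
    P.homToXZero R N ≫ (P.complex.linearYonedaObj R N).d 0 1 = 0 := by
  refine ModuleCat.hom_ext (LinearMap.ext fun z => ?_)
  exact (Category.assoc _ _ _).symm.trans ((congrArg (· ≫ z) P.complex_d_comp_π_f_zero).trans
    zero_comp)

/-- The map from homomorphisms to the zeroth cohomology. -/
noncomputable def homToHomologyZero {X : C} (P : ProjectiveResolution X) (N : C) :
    ModuleCat.of R (X ⟶ N) ⟶ (P.complex.linearYonedaObj R N).homology 0 :=
  (P.complex.linearYonedaObj R N).liftCycles (P.homToXZero R N) 1 (by simp) (P.homToXZero_d R N) ≫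
    (P.complex.linearYonedaObj R N).homologyπ 0

lemma homToHomologyZero_comp_linearYonedaMapRight {X : C} (P : ProjectiveResolution X)
    {N N' : C} (g : N ⟶ N') :
    P.homToHomologyZero R N ≫ HomologicalComplex.homologyMap
      (ChainComplex.linearYonedaMapRight R P.complex g) 0 =
    ModuleCat.ofHom (Linear.rightComp R X g) ≫ P.homToHomologyZero R N' := by
  rw [homToHomologyZero, Category.assoc, HomologicalComplex.homologyπ_naturality,
    HomologicalComplex.liftCycles_comp_cyclesMap_assoc, homToHomologyZero,
    HomologicalComplex.comp_liftCycles_assoc]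
  congr 2
  exact ModuleCat.hom_ext (LinearMap.ext fun z => Category.assoc _ _ _)

lemma homToHomologyZero_comp_linearYonedaMap {X Y : C} (P : ProjectiveResolution X)
    (Q : ProjectiveResolution Y) (f : X ⟶ Y) (φ : P.complex ⟶ Q.complex)
    (comm : φ.f 0 ≫ Q.π.f 0 = P.π.f 0 ≫ f) (N : C) :
    Q.homToHomologyZero R N ≫
        HomologicalComplex.homologyMap (ChainComplex.linearYonedaMap R φ N) 0 =
      ModuleCat.ofHom (Linear.leftComp R N f) ≫ P.homToHomologyZero R N := by
  rw [homToHomologyZero, Category.assoc, HomologicalComplex.homologyπ_naturality,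
    HomologicalComplex.liftCycles_comp_cyclesMap_assoc, homToHomologyZero,
    HomologicalComplex.comp_liftCycles_assoc]
  congr 2
  refine ModuleCat.hom_ext (LinearMap.ext fun z => ?_)
  exact (Category.assoc _ _ _).symm.trans ((congrArg (· ≫ z) comm).trans (Category.assoc _ _ _))

lemma homToHomologyZero_surjective {X : C} (P : ProjectiveResolution X) (N : C) :
    Function.Surjective (P.homToHomologyZero R N) := by
  rw [← ModuleCat.epi_iff_surjective]
  refine @epi_comp _ _ _ _ _ _ ?_ _ _
  rw [ModuleCat.epi_iff_surjective]
  intro z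
  let K := P.complex.linearYonedaObj R N
  let f : P.complex.X 0 ⟶ N := K.iCycles 0 z
  have hf : P.complex.d 1 0 ≫ f = 0 :=
    congrArg (fun φ : K.cycles 0 ⟶ K.X 1 => φ z) (K.iCycles_d 0 1)
  refine ⟨P.exact₀.desc f hf, ?_⟩
  apply (ModuleCat.mono_iff_injective (K.iCycles 0)).1 inferInstance
  refine (congrArg (fun φ : _ ⟶ K.X 0 => φ (P.exact₀.desc f hf))
    (K.liftCycles_i (P.homToXZero R N) 1 (by simp) (P.homToXZero_d R N))).trans ?_
  exact P.exact₀.g_desc f hf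

end CategoryTheory.ProjectiveResolution

end

section
open Limits

namespace localCohomology

variable {R : Type u} [CommRing R] (𝔞 : Ideal R)

/-- The class in local cohomology of a homomorphism `R ⧸ 𝔞 ^ n ⟶ N`. -/
noncomputable def ofHomQuotientPow (j : ℕᵒᵖ) (N : ModuleCat.{u} R) :
    ModuleCat.of R ((ringModIdeals (idealPowersDiagram 𝔞)).obj j ⟶ N) ⟶
      (cohomologyFunctor 𝔞 0).obj N :=
  (ModuleCat.functorialProjectiveResolution
      ((ringModIdeals (idealPowersDiagram 𝔞)).obj j)).homToHomologyZero R N ≫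
    (HomologicalComplex.homologyFunctor _ _ 0).map (colimit.ι (complexDiagram 𝔞 N) (op j))

lemma exists_ofHomQuotientPow_eq {N : ModuleCat.{u} R} (z : (cohomologyFunctor 𝔞 0).obj N) :
    ∃ (j : ℕᵒᵖ) (y : (ringModIdeals (idealPowersDiagram 𝔞)).obj j ⟶ N),
      ofHomQuotientPow 𝔞 j N y = z := by
  have := preservesSmallestFilteredColimits_of_preservesFilteredColimits
    (forget (ModuleCat.{u} R))
  obtain ⟨j, x, hx⟩ := Concrete.isColimit_exists_rep (complexDiagram 𝔞 N ⋙
    HomologicalComplex.homologyFunctor _ _ 0)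
    (isColimitOfPreserves (HomologicalComplex.homologyFunctor _ _ 0)
      (colimit.isColimit (complexDiagram 𝔞 N))) z
  obtain ⟨y, hy⟩ := (ModuleCat.functorialProjectiveResolution
      ((ringModIdeals (idealPowersDiagram 𝔞)).obj j.unop)).homToHomologyZero_surjective R N x
  refine ⟨j.unop, y, Eq.trans ?_ hx⟩
  exact congrArg ((HomologicalComplex.homologyFunctor _ _ 0).map
    (colimit.ι (complexDiagram 𝔞 N) j)) hy

lemma cohomologyFunctor_map_ofHomQuotientPow (j : ℕᵒᵖ) {N N' : ModuleCat.{u} R} (g : N ⟶ N')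
    (y : (ringModIdeals (idealPowersDiagram 𝔞)).obj j ⟶ N) :
    (cohomologyFunctor 𝔞 0).map g (ofHomQuotientPow 𝔞 j N y) =
      ofHomQuotientPow 𝔞 j N' (y ≫ g) := by
  have h₁ := (ModuleCat.functorialProjectiveResolution
    ((ringModIdeals (idealPowersDiagram 𝔞)).obj j)).homToHomologyZero_comp_linearYonedaMapRight R g
  have h₂ := congrArg (HomologicalComplex.homologyFunctor _ _ 0).map
    (ι_colimMap ((diagramFunctor 𝔞).map g) (op j))
  have h₃ : ofHomQuotientPow 𝔞 j N ≫ (cohomologyFunctor 𝔞 0).map g =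
      ModuleCat.ofHom (Linear.rightComp R _ g) ≫ ofHomQuotientPow 𝔞 j N' := by
    refine (Category.assoc _ _ _).trans ?_
    refine Eq.trans ?_ (Category.assoc _ _ _)
    refine Eq.trans ?_ (congrArg (· ≫ _) h₁)
    refine Eq.trans ?_ (Category.assoc _ _ _).symm
    refine congrArg (_ ≫ ·) ?_
    exact (CategoryTheory.Functor.map_comp _ _ _).symm.trans
      (h₂.trans (CategoryTheory.Functor.map_comp _ _ _))
  exact congrArg (fun φ => φ y) (congrArg ModuleCat.Hom.hom h₃)

lemma ofHomQuotientPow_map_comp {j j' : ℕᵒᵖ} (f : j ⟶ j') {N : ModuleCat.{u} R}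
    (y : (ringModIdeals (idealPowersDiagram 𝔞)).obj j' ⟶ N) :
    ofHomQuotientPow 𝔞 j N ((ringModIdeals (idealPowersDiagram 𝔞)).map f ≫ y) =
      ofHomQuotientPow 𝔞 j' N y := by
  have h₁ := ProjectiveResolution.homToHomologyZero_comp_linearYonedaMap R
    (ModuleCat.functorialProjectiveResolution ((ringModIdeals (idealPowersDiagram 𝔞)).obj j))
    (ModuleCat.functorialProjectiveResolution ((ringModIdeals (idealPowersDiagram 𝔞)).obj j'))
    ((ringModIdeals (idealPowersDiagram 𝔞)).map f) ((ModuleCat.functorialResolution R).map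
      ((ringModIdeals (idealPowersDiagram 𝔞)).map f))
    (ModuleCat.functorialResolution_map_f_zero_comp _) N
  have h₂ := congrArg (HomologicalComplex.homologyFunctor _ _ 0).map
    (colimit.w (complexDiagram 𝔞 N) f.op)
  have h₃ : ofHomQuotientPow 𝔞 j' N = ModuleCat.ofHom (Linear.leftComp R N
      ((ringModIdeals (idealPowersDiagram 𝔞)).map f)) ≫ ofHomQuotientPow 𝔞 j N := by
    refine Eq.trans ?_ (Category.assoc _ _ _)
    refine Eq.trans ?_ (congrArg (· ≫ _) h₁)
    refine Eq.trans ?_ (Category.assoc _ _ _).symm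
    refine congrArg (_ ≫ ·) ?_
    exact (h₂.symm.trans (CategoryTheory.Functor.map_comp _ _ _))
  exact congrArg (fun φ => φ y) (congrArg ModuleCat.Hom.hom h₃.symm)

end localCohomology

end

namespace localCohomology

variable {R : Type u} [CommRing R] (𝔞 : Ideal R)

section

variable (i : ℕ) {M N P : Type u} [AddCommGroup M] [Module R M] [AddCommGroup N] [Module R N]
  [AddCommGroup P] [Module R P]

/-- Local cohomology of an unbundled module. -/
noncomputable abbrev Cohomology (M : Type u) [AddCommGroup M] [Module R M] : Type u :=
  (cohomologyFunctor 𝔞 i).obj (ModuleCat.of R M)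

/-- The map on local cohomology induced by a linear map. -/
noncomputable def cohomologyMap (f : M →ₗ[R] N) : Cohomology 𝔞 i M →ₗ[R] Cohomology 𝔞 i N :=
  ((cohomologyFunctor 𝔞 i).map (ModuleCat.ofHom f)).hom

lemma cohomologyMap_smul_id (r : R) :
    cohomologyMap 𝔞 i (r • LinearMap.id : M →ₗ[R] M) = r • LinearMap.id := by
  have h := cohomologyFunctor_map_smul 𝔞 i r (𝟙 (ModuleCat.of R M))
  exact congrArg ModuleCat.Hom.hom
    (h.trans (congrArg (r • ·) ((cohomologyFunctor 𝔞 i).map_id _)))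

variable {f : M →ₗ[R] N} {g : N →ₗ[R] P}

lemma shortExact_of_exact (hf : Function.Injective f) (hg : Function.Surjective g)
    (hfg : Function.Exact f g) : (ShortComplex.mk (ModuleCat.ofHom f) (ModuleCat.ofHom g)
    (ModuleCat.hom_ext hfg.linearMap_comp_eq_zero)).ShortExact where
  mono_f := (ModuleCat.mono_iff_injective _).2 hf
  epi_g := (ModuleCat.epi_iff_surjective _).2 hg
  exact := (ShortComplex.ShortExact.moduleCat_exact_iff_function_exact _).2 hfg

lemma exact_cohomologyMap (hf : Function.Injective f) (hg : Function.Surjective g)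
    (hfg : Function.Exact f g) : Function.Exact (cohomologyMap 𝔞 i f) (cohomologyMap 𝔞 i g) :=
  exact_cohomologyFunctor_map (shortExact_of_exact hf hg hfg) i

lemma exists_connectingMap (hf : Function.Injective f) (hg : Function.Surjective g)
    (hfg : Function.Exact f g) : ∃ δ : Cohomology 𝔞 i P →ₗ[R] Cohomology 𝔞 (i + 1) M,
      Function.Exact (cohomologyMap 𝔞 i g) δ ∧ Function.Exact δ (cohomologyMap 𝔞 (i + 1) f) :=
  exists_connectingHom (shortExact_of_exact hf hg hfg) i

end

lemma exists_injective_module (N : Type u) [AddCommGroup N] [Module R N] :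
    ∃ (E : Type u) (_ : AddCommGroup E) (_ : Module R E) (f : N →ₗ[R] E),
      Module.Injective R E ∧ Function.Injective f :=
  let E : ModuleCat.{u} R := Injective.under (ModuleCat.of R N)
  ⟨E, inferInstance, inferInstance, (Injective.ι (ModuleCat.of R N)).hom,
    Module.injective_module_of_injective_object R E
      (inj := inferInstanceAs (Injective (Injective.under (ModuleCat.of R N)))),
    (ModuleCat.mono_iff_injective _).1 inferInstance⟩

lemma subsingleton_cohomology_of_injective (i : ℕ) (E : Type u) [AddCommGroup E] [Module R E]
    [Module.Injective R E] : Subsingleton (Cohomology 𝔞 (i + 1) E) := by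
  have := Module.injective_object_of_injective_module R E
  exact ModuleCat.subsingleton_of_isZero (isZero_cohomologyFunctor_obj_of_injective 𝔞 _ i)

/-- Every cohomology class is the image of one under a connecting map. -/
lemma exists_connectingMap_surjective (i : ℕ) {N E : Type u} [AddCommGroup N] [Module R N]
    [AddCommGroup E] [Module R E] [Module.Injective R E] {f : N →ₗ[R] E}
    (hf : Function.Injective f) :
    ∃ δ : Cohomology 𝔞 i (E ⧸ LinearMap.range f) →ₗ[R] Cohomology 𝔞 (i + 1) N,
      Function.Exact (cohomologyMap 𝔞 i (LinearMap.range f).mkQ) δ ∧ Function.Surjective δ := by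
  obtain ⟨δ, h₁, h₂⟩ := exists_connectingMap 𝔞 i hf (Submodule.mkQ_surjective _)
    (LinearMap.exact_map_mkQ_range f)
  have := subsingleton_cohomology_of_injective 𝔞 i E
  exact ⟨δ, h₁, fun z => (h₂ z).1 (Subsingleton.elim _ _)⟩

/-- The submodule of elements annihilated by some power of `𝔞`. -/
def powTorsion (N : Type*) [AddCommGroup N] [Module R N] : Submodule R N where
  carrier := {x | ∃ n : ℕ, ∀ a ∈ 𝔞 ^ n, a • x = 0}
  zero_mem' := ⟨0, fun a _ => smul_zero a⟩
  add_mem' := by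
    rintro x y ⟨n, hn⟩ ⟨m, hm⟩
    refine ⟨n + m, fun a ha => ?_⟩
    rw [smul_add, hn a (Ideal.pow_le_pow_right (Nat.le_add_right _ _) ha),
      hm a (Ideal.pow_le_pow_right (Nat.le_add_left _ _) ha), add_zero]
  smul_mem' := by
    rintro r x ⟨n, hn⟩
    exact ⟨n, fun a ha => by rw [smul_comm, hn a ha, smul_zero]⟩

variable {𝔞} in
lemma mem_powTorsion {N : Type*} [AddCommGroup N] [Module R N] {x : N} :
    x ∈ powTorsion 𝔞 N ↔ ∃ n : ℕ, ∀ a ∈ 𝔞 ^ n, a • x = 0 := Iff.rfl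

variable {𝔞} in
lemma mem_powTorsion_map {M N : Type*} [AddCommGroup N] [Module R N] [AddCommGroup M] [Module R M]
    (f : M →ₗ[R] N) {x : M} (hx : x ∈ powTorsion 𝔞 M) : f x ∈ powTorsion 𝔞 N := by
  obtain ⟨n, hn⟩ := hx
  exact ⟨n, fun a ha => by rw [← map_smul, hn a ha, map_zero]⟩

lemma powTorsion_cohomology (i : ℕ) (N : Type u) [AddCommGroup N] [Module R N] :
    powTorsion 𝔞 (Cohomology 𝔞 i N) = ⊤ := by
  refine Submodule.eq_top_iff'.2 fun z => ?_
  induction i generalizing N with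
  | zero =>
    obtain ⟨j, y, rfl⟩ := exists_ofHomQuotientPow_eq 𝔞 z
    refine ⟨j.unop, fun a ha => ?_⟩
    refine (map_smul (ofHomQuotientPow 𝔞 j (ModuleCat.of R N)).hom a y).symm.trans ?_
    refine (congrArg (ofHomQuotientPow 𝔞 j (ModuleCat.of R N)).hom ?_).trans (map_zero _)
    refine ModuleCat.hom_ext (LinearMap.ext fun w => ?_)
    obtain ⟨w, rfl⟩ := Ideal.Quotient.mk_surjective w
    refine (map_smul y.hom a _).symm.trans ?_
    refine (congrArg y.hom ?_).trans (map_zero _)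
    exact Ideal.Quotient.eq_zero_iff_mem.2 (Ideal.mul_mem_right w _ ha)
  | succ i ih =>
    obtain ⟨E, _, _, f, _, hf⟩ := exists_injective_module (R := R) N
    obtain ⟨δ, -, hδ⟩ := exists_connectingMap_surjective 𝔞 i hf
    obtain ⟨z, rfl⟩ := hδ z
    exact mem_powTorsion_map δ (ih _ z)

lemma cohomologyMap_zero_surjective {M N : Type u} [AddCommGroup N] [Module R N] [AddCommGroup M]
    [Module R M] (hM : powTorsion 𝔞 M = ⊤) (f : M →ₗ[R] N) (hf : Function.Surjective f) :
    Function.Surjective (cohomologyMap 𝔞 0 f) := by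
  intro z
  obtain ⟨⟨n⟩, y, rfl⟩ := exists_ofHomQuotientPow_eq 𝔞 z
  obtain ⟨b, hb⟩ := hf (y.hom (Ideal.Quotient.mk _ 1))
  obtain ⟨m, hm⟩ := mem_powTorsion.1 ((Submodule.eq_top_iff'.1 hM) b)
  let k := n + m
  let g : (ringModIdeals (idealPowersDiagram 𝔞)).obj (op k) ⟶ ModuleCat.of R M :=
    ModuleCat.ofHom (Submodule.liftQ (𝔞 ^ k) (LinearMap.toSpanSingleton R M b) fun a ha =>
      hm a (Ideal.pow_le_pow_right (Nat.le_add_left _ _) ha))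
  let φ : op k ⟶ op n := (homOfLE (Nat.le_add_right n m)).op
  refine ⟨ofHomQuotientPow 𝔞 (op k) _ g, ?_⟩
  refine (cohomologyFunctor_map_ofHomQuotientPow 𝔞 _ (ModuleCat.ofHom f) g).trans ?_
  refine Eq.trans ?_ (ofHomQuotientPow_map_comp 𝔞 φ y)
  refine congrArg (ofHomQuotientPow 𝔞 (op k) (ModuleCat.of R N)).hom ?_
  refine ModuleCat.hom_ext (Submodule.linearMap_qext _ (LinearMap.ext_ring ?_))
  refine (congrArg f (one_smul R b)).trans hb

lemma exists_pow_smul_eq_zero_of_fg {N : Type*} [AddCommGroup N] [Module R N]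
    (hN : powTorsion 𝔞 N = ⊤) {P : Submodule R N} (hP : P.FG) :
    ∃ n : ℕ, ∀ a ∈ 𝔞 ^ n, ∀ x ∈ P, a • x = 0 := by
  induction P, hP using Submodule.fg_induction with
  | singleton x =>
    obtain ⟨n, hn⟩ := mem_powTorsion.1 (Submodule.eq_top_iff'.1 hN x)
    refine ⟨n, fun a ha y hy => ?_⟩
    obtain ⟨r, rfl⟩ := Submodule.mem_span_singleton.1 hy
    rw [smul_comm, hn a ha, smul_zero]
  | sup P Q hP hQ ihP ihQ =>
    obtain ⟨n, hn⟩ := ihP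
    obtain ⟨m, hm⟩ := ihQ
    refine ⟨n + m, fun a ha x hx => ?_⟩
    obtain ⟨y, hy, z, hz, rfl⟩ := Submodule.mem_sup.1 hx
    rw [smul_add, hn a (Ideal.pow_le_pow_right (Nat.le_add_right _ _) ha) y hy,
      hm a (Ideal.pow_le_pow_right (Nat.le_add_left _ _) ha) z hz, add_zero]

lemma powTorsion_powTorsion (N : Type*) [AddCommGroup N] [Module R N] :
    powTorsion 𝔞 (powTorsion 𝔞 N) = ⊤ := by
  refine Submodule.eq_top_iff'.2 fun ⟨x, n, hn⟩ => ⟨n, fun a ha => Subtype.ext (hn a ha)⟩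

lemma injective_powTorsion [IsNoetherianRing R] (E : Type u) [AddCommGroup E] [Module R E]
    [Module.Injective R E] : Module.Injective R (powTorsion 𝔞 E) := by
  refine Module.Baer.injective fun I f => ?_
  obtain ⟨n, hn⟩ := exists_pow_smul_eq_zero_of_fg 𝔞 (powTorsion_powTorsion 𝔞 E)
    ((IsNoetherian.noetherian (⊤ : Submodule R I)).map f)
  obtain ⟨k, hk⟩ := Ideal.exists_pow_inf_eq_pow_smul 𝔞 (I : Submodule R R)
  have hle : 𝔞 ^ (n + k) ⊓ I ≤ 𝔞 ^ n * I := by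
    have h := hk (n + k) (Nat.le_add_left _ _)
    rw [Nat.add_sub_cancel, smul_eq_mul, smul_eq_mul, Ideal.mul_top] at h
    exact h.le.trans (Ideal.mul_mono_right inf_le_right)
  have hf : ∀ x (hx : x ∈ I), x ∈ 𝔞 ^ (n + k) → f ⟨x, hx⟩ = 0 := by
    intro x hx hx'
    have key : 𝔞 ^ n * I ≤ ((LinearMap.ker f).map I.subtype : Submodule R R) := by
      refine Ideal.mul_le.2 fun a ha y hy => ?_
      refine ⟨a • ⟨y, hy⟩, ?_, rfl⟩
      rw [SetLike.mem_coe, LinearMap.mem_ker, map_smul]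
      exact hn a ha _ ⟨_, trivial, rfl⟩
    obtain ⟨y, hy, hyx⟩ := key (hle ⟨hx', hx⟩)
    have : (⟨x, hx⟩ : I) = y := Subtype.ext hyx.symm
    rw [this]
    exact hy
  let h : I →ₗ[R] R ⧸ 𝔞 ^ (n + k) := (Submodule.mkQ (𝔞 ^ (n + k))) ∘ₗ I.subtype
  have hh : LinearMap.ker h ≤ LinearMap.ker ((powTorsion 𝔞 E).subtype ∘ₗ f) := by
    rintro ⟨x, hx⟩ hx'
    rw [LinearMap.mem_ker, LinearMap.comp_apply, hf x hx ((Submodule.Quotient.mk_eq_zero _).1 hx'),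
      map_zero]
  obtain ⟨g, hg⟩ := Module.Injective.out ((LinearMap.ker h).liftQ h le_rfl)
    (LinearMap.ker_eq_bot.1 (Submodule.ker_liftQ_eq_bot _ _ _ le_rfl))
    ((LinearMap.ker h).liftQ ((powTorsion 𝔞 E).subtype ∘ₗ f) hh)
  refine ⟨LinearMap.codRestrict _ (g ∘ₗ Submodule.mkQ (𝔞 ^ (n + k))) fun r =>
    ⟨n + k, fun a ha => ?_⟩, fun x hx => Subtype.ext (hg (Submodule.Quotient.mk ⟨x, hx⟩))⟩
  rw [← map_smul]
  refine (congrArg g ?_).trans (map_zero g)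
  exact (Submodule.Quotient.mk_eq_zero _).2 (Ideal.mul_mem_right r _ ha)

lemma subsingleton_cohomology_of_powTorsion_eq_top [IsNoetherianRing R] (i : ℕ) {N : Type u}
    [AddCommGroup N] [Module R N] (hN : powTorsion 𝔞 N = ⊤) :
    Subsingleton (Cohomology 𝔞 (i + 1) N) := by
  induction i generalizing N with
  | zero =>
    obtain ⟨E, _, _, f, _, hf⟩ := exists_injective_module (R := R) N
    have := injective_powTorsion 𝔞 E
    let f' : N →ₗ[R] powTorsion 𝔞 E := f.codRestrict _ fun x =>
      mem_powTorsion_map f (Submodule.eq_top_iff'.1 hN x)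
    have hf' : Function.Injective f' := fun x y h => hf (congrArg Subtype.val h)
    obtain ⟨δ, h₁, h₂⟩ := exists_connectingMap_surjective 𝔞 0 hf'
    have h₃ := cohomologyMap_zero_surjective 𝔞 (powTorsion_powTorsion 𝔞 E)
      (LinearMap.range f').mkQ (Submodule.mkQ_surjective _)
    refine subsingleton_of_forall_eq 0 fun z => ?_
    obtain ⟨y, rfl⟩ := h₂ z
    exact (h₁ y).2 (h₃ y)
  | succ i ih =>
    obtain ⟨E, _, _, f, _, hf⟩ := exists_injective_module (R := R) N
    have := injective_powTorsion 𝔞 E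
    let f' : N →ₗ[R] powTorsion 𝔞 E := f.codRestrict _ fun x =>
      mem_powTorsion_map f (Submodule.eq_top_iff'.1 hN x)
    have hf' : Function.Injective f' := fun x y h => hf (congrArg Subtype.val h)
    obtain ⟨δ, h₁, h₂⟩ := exists_connectingMap_surjective 𝔞 (i + 1) hf'
    have : Subsingleton (Cohomology 𝔞 (i + 1) (powTorsion 𝔞 E ⧸ LinearMap.range f')) := by
      refine ih (Submodule.eq_top_iff'.2 fun z => ?_)
      obtain ⟨y, rfl⟩ := Submodule.mkQ_surjective _ z
      exact mem_powTorsion_map _ (Submodule.eq_top_iff'.1 (powTorsion_powTorsion 𝔞 E) y)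
    exact h₂.subsingleton

end localCohomology

section

variable {R : Type*} [CommRing R]

section

variable {H C D : Type*} [AddCommGroup H] [Module R H] [AddCommGroup C] [Module R C]
  [AddCommGroup D] [Module R D]

lemma isArtinian_of_exact [IsArtinian R H] [IsArtinian R D] {f : H →ₗ[R] C} {g : C →ₗ[R] D}
    (h : Function.Exact f g) : IsArtinian R C :=
  isArtinian_of_range_eq_ker f g h.linearMap_ker_eq.symm

lemma isArtinian_of_exact_of_isArtinian_range [IsArtinian R D] {f : H →ₗ[R] C} {g : C →ₗ[R] D}
    [IsArtinian R (LinearMap.range f)] (h : Function.Exact f g) : IsArtinian R C :=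
  isArtinian_of_range_eq_ker (LinearMap.range f).subtype g
    ((Submodule.range_subtype _).trans h.linearMap_ker_eq.symm)

lemma isArtinian_range_smul_of_exact [IsArtinian R D] {β : H →ₗ[R] C} {δ : C →ₗ[R] D}
    (h : Function.Exact β δ) (r : R)
    [IsArtinian R (LinearMap.range (r • LinearMap.id : H →ₗ[R] H))] :
    IsArtinian R (LinearMap.range (r • LinearMap.id : C →ₗ[R] C)) := by
  set S : Submodule R C := (LinearMap.range (r • LinearMap.id : H →ₗ[R] H)).map β
  have : IsArtinian R S := isArtinian_of_surjective _
    (β.submoduleMap (LinearMap.range (r • LinearMap.id : H →ₗ[R] H)))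
    (β.submoduleMap_surjective _)
  have : IsArtinian R (C ⧸ LinearMap.ker δ) := isArtinian_of_injective
    ((LinearMap.ker δ).liftQ δ le_rfl)
    (LinearMap.ker_eq_bot.1 (Submodule.ker_liftQ_eq_bot _ _ _ le_rfl))
  let k : C →ₗ[R] C ⧸ S := S.mkQ ∘ₗ (r • LinearMap.id)
  have hk : LinearMap.ker δ ≤ LinearMap.ker k := by
    rw [h.linearMap_ker_eq]
    rintro _ ⟨x, rfl⟩
    exact (Submodule.Quotient.mk_eq_zero _).2 ⟨r • x, ⟨x, rfl⟩, map_smul β r x⟩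
  have : IsArtinian R (LinearMap.range k) := by
    rw [← Submodule.range_liftQ _ _ hk]
    exact isArtinian_of_surjective _ _ (LinearMap.surjective_rangeRestrict _)
  refine isArtinian_of_exact (H := S) (D := LinearMap.range k)
    (f := Submodule.inclusion ?_)
    (g := (S.mkQ ∘ₗ Submodule.subtype _).codRestrict _ ?_) ?_
  · rintro _ ⟨_, ⟨x, rfl⟩, rfl⟩
    exact ⟨β x, (map_smul β r x).symm⟩
  · rintro ⟨_, ⟨x, rfl⟩⟩
    exact ⟨x, rfl⟩
  · intro y
    rw [← Subtype.coe_inj]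
    refine (Submodule.Quotient.mk_eq_zero S).trans ⟨fun hy => ⟨⟨y, hy⟩, rfl⟩, ?_⟩
    rintro ⟨z, rfl⟩
    exact z.2

end

lemma associatedPrimes_finite_of_surjective {N P : Type*} [AddCommGroup N] [Module R N]
    [AddCommGroup P] [Module R P] (hN : ∀ N' : Submodule R N, (associatedPrimes R (N ⧸ N')).Finite)
    {g : N →ₗ[R] P} (hg : Function.Surjective g) (P' : Submodule R P) :
    (associatedPrimes R (P ⧸ P')).Finite := by
  have e := (P'.mkQ ∘ₗ g).quotKerEquivOfSurjective (P'.mkQ_surjective.comp hg)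
  exact LinearEquiv.AssociatedPrimes.eq e ▸ hN _

lemma krullDim_support_quotient_lt [IsNoetherianRing R] {N : Type*} [AddCommGroup N] [Module R N]
    {x : R} (hx : Function.Injective (x • LinearMap.id : N →ₗ[R] N)) {d : ℕ}
    (hd : Order.krullDim (Module.support R N) < (d + 1 : ℕ)) :
    Order.krullDim (Module.support R (N ⧸ LinearMap.range (x • LinearMap.id : N →ₗ[R] N))) <
      (d : ℕ) := by
  rw [Order.krullDim_lt_coe_iff] at hd ⊢
  intro l
  have hle : Module.support R (N ⧸ LinearMap.range (x • LinearMap.id : N →ₗ[R] N)) ⊆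
    Module.support R N := Module.support_subset_of_surjective _ (Submodule.mkQ_surjective _)
  obtain ⟨r, hr, hlt⟩ : ∃ r ∈ Module.support R N, r < l.head.1 := by
    obtain ⟨m, hm⟩ := Module.mem_support_iff'.1 l.head.2
    obtain ⟨m, rfl⟩ := Submodule.mkQ_surjective _ m
    have hxp : x ∈ l.head.1.asIdeal := by
      by_contra h
      refine hm x h ?_
      rw [← map_smul]
      exact (Submodule.Quotient.mk_eq_zero _).2 ⟨m, rfl⟩
    have hmp : l.head.1 ∈ Module.support R (Submodule.span R {m}) :=
      Module.mem_support_iff'.2 ⟨⟨m, Submodule.mem_span_singleton_self m⟩, fun r hr h =>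
        hm r hr (by rw [← map_smul, show r • m = 0 from congrArg Subtype.val h, map_zero])⟩
    obtain ⟨r, hrm, hr⟩ := Ideal.exists_minimalPrimes_le (Module.mem_support_iff_of_finite.1 hmp)
    have hreg : IsSMulRegular (Submodule.span R {m}) x := fun a b hab =>
      Subtype.ext (hx (congrArg Subtype.val hab))
    refine ⟨⟨r, hrm.1.1⟩, Module.support_subset_of_injective (Submodule.subtype _)
      Subtype.val_injective (Module.mem_support_iff_of_finite.2 hrm.1.2), lt_of_le_of_ne hr ?_⟩
    intro h
    exact hreg.notMem_of_mem_minimalPrimes hrm ((congrArg PrimeSpectrum.asIdeal h).ge hxp)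
  let l' : LTSeries (Module.support R N) := l.map (Set.inclusion hle) fun _ _ h => h
  have hlt' : (⟨r, hr⟩ : Module.support R N) < l'.head := hlt
  exact Nat.lt_of_succ_lt_succ
    ((RelSeries.cons_length l' ⟨r, hr⟩ hlt').symm.trans_lt (hd (l'.cons ⟨r, hr⟩ hlt')))

end

namespace localCohomology

variable {R : Type u} [CommRing R] [IsNoetherianRing R] (𝔞 : Ideal R)

lemma eq_zero_of_smul_eq_zero_quotient_powTorsion {N : Type*} [AddCommGroup N] [Module R N]
    {z : N ⧸ powTorsion 𝔞 N} (hz : ∀ a ∈ 𝔞, a • z = 0) : z = 0 := by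
  obtain ⟨z, rfl⟩ := Submodule.mkQ_surjective _ z
  let f : 𝔞 →ₗ[R] powTorsion 𝔞 N :=
    (LinearMap.toSpanSingleton R N z ∘ₗ 𝔞.subtype).codRestrict _ fun a =>
      (Submodule.Quotient.mk_eq_zero _).1 (hz a.1 a.2)
  obtain ⟨n, hn⟩ := exists_pow_smul_eq_zero_of_fg 𝔞 (powTorsion_powTorsion 𝔞 N)
    ((IsNoetherian.noetherian (⊤ : Submodule R 𝔞)).map f)
  refine (Submodule.Quotient.mk_eq_zero _).2 (mem_powTorsion.2 ⟨n + 1, fun a ha => ?_⟩)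
  rw [pow_succ] at ha
  induction ha using Submodule.mul_induction_on' with
  | mem_mul_mem a ha b hb =>
    rw [mul_smul]
    exact congrArg Subtype.val (hn a ha (f ⟨b, hb⟩) ⟨_, trivial, rfl⟩)
  | add a _ b _ ha hb => rw [add_smul, ha, hb, add_zero]

lemma exists_injective_smul_quotient_powTorsion {N : Type*} [AddCommGroup N] [Module R N]
    (h : (associatedPrimes R (N ⧸ powTorsion 𝔞 N)).Finite) :
    ∃ x ∈ 𝔞, Function.Injective
      (x • LinearMap.id : (N ⧸ powTorsion 𝔞 N) →ₗ[R] N ⧸ powTorsion 𝔞 N) := by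
  have h₁ : ¬ (𝔞 : Set R) ⊆ ⋃ p ∈ associatedPrimes R (N ⧸ powTorsion 𝔞 N), (p : Set R) := by
    intro h₁
    obtain ⟨p, hp, hle⟩ :=
      (Ideal.subset_union_prime_finite h (f := id) ⊥ ⊥ fun p hp _ _ => hp.isPrime).1 h₁
    obtain ⟨hp, z, rfl⟩ := isAssociatedPrime_iff.1 hp
    have hz := eq_zero_of_smul_eq_zero_quotient_powTorsion 𝔞 fun a ha =>
      Submodule.mem_colon_singleton.1 (hle ha)
    exact hp.ne_top (by simp [hz])
  rw [biUnion_associatedPrimes_eq_zero_divisors] at h₁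
  obtain ⟨x, hx, hx'⟩ := Set.not_subset.1 h₁
  refine ⟨x, hx, (injective_iff_map_eq_zero _).2 fun y hy => ?_⟩
  by_contra hy'
  exact hx' ⟨y, hy', hy⟩

lemma nonempty_cohomology_equiv_quotient_powTorsion {i : ℕ} (hi : 0 < i) (N : Type u)
    [AddCommGroup N] [Module R N] :
    Nonempty (Cohomology 𝔞 i N ≃ₗ[R] Cohomology 𝔞 i (N ⧸ powTorsion 𝔞 N)) := by
  obtain ⟨i, rfl⟩ := Nat.exists_eq_succ_of_ne_zero hi.ne'
  have hf := (powTorsion 𝔞 N).subtype_injective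
  have hg := (powTorsion 𝔞 N).mkQ_surjective
  have hfg := LinearMap.exact_subtype_mkQ (powTorsion 𝔞 N)
  have := subsingleton_cohomology_of_powTorsion_eq_top 𝔞 i (powTorsion_powTorsion 𝔞 N)
  have := subsingleton_cohomology_of_powTorsion_eq_top 𝔞 (i + 1) (powTorsion_powTorsion 𝔞 N)
  obtain ⟨δ, h₁, _⟩ := exists_connectingMap 𝔞 (i + 1) hf hg hfg
  refine ⟨LinearEquiv.ofBijective (cohomologyMap 𝔞 (i + 1) (powTorsion 𝔞 N).mkQ) ⟨?_, ?_⟩⟩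
  · refine (injective_iff_map_eq_zero _).2 fun y hy => ?_
    obtain ⟨z, rfl⟩ := (exact_cohomologyMap 𝔞 (i + 1) hf hg hfg y).1 hy
    rw [Subsingleton.elim z 0, map_zero]
  · exact fun y => (h₁ y).1 (Subsingleton.elim _ _)

/-- If some power of each element of `𝔞` maps the top non-Artinian local cohomology module onto
an Artinian submodule, then that module is itself Artinian. -/
theorem isArtinian_cohomology {q : ℕ} (hq : 0 < q) (d : ℕ) {N : Type u} [AddCommGroup N]
    [Module R N] (hN : ∀ N' : Submodule R N, (associatedPrimes R (N ⧸ N')).Finite)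
    (hd : Order.krullDim (Module.support R N) < (d : ℕ))
    (h_art : ∀ i, q < i → IsArtinian R (Cohomology 𝔞 i N))
    (h : ∀ x ∈ 𝔞, ∃ n : ℕ, IsArtinian R
      (LinearMap.range (x ^ n • LinearMap.id : Cohomology 𝔞 q N →ₗ[R] Cohomology 𝔞 q N))) :
    IsArtinian R (Cohomology 𝔞 q N) := by
  induction d generalizing N with
  | zero =>
    obtain ⟨q, rfl⟩ := Nat.exists_eq_succ_of_ne_zero hq.ne'
    have : IsEmpty (Module.support R N) :=
      not_nonempty_iff.1 fun ⟨p⟩ =>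
        (Order.krullDim_lt_coe_iff.1 hd (RelSeries.singleton _ p)).not_ge (Nat.zero_le _)
    have := Module.support_eq_empty_iff.1 (Set.isEmpty_coe_sort.1 this)
    have := subsingleton_cohomology_of_powTorsion_eq_top 𝔞 q (N := N)
      (Subsingleton.elim _ _)
    infer_instance
  | succ d ih =>
    set G := N ⧸ powTorsion 𝔞 N
    have hG := associatedPrimes_finite_of_surjective hN (powTorsion 𝔞 N).mkQ_surjective
    have h_artG : ∀ i, q < i → IsArtinian R (Cohomology 𝔞 i G) := fun i hi => by
      obtain ⟨e⟩ := nonempty_cohomology_equiv_quotient_powTorsion 𝔞 (hq.trans hi) N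
      have := h_art i hi
      exact isArtinian_of_linearEquiv e
    obtain ⟨e⟩ := nonempty_cohomology_equiv_quotient_powTorsion 𝔞 hq N
    have hP : ∀ x ∈ 𝔞, ∃ n : ℕ, IsArtinian R
        (LinearMap.range (x ^ n • LinearMap.id : Cohomology 𝔞 q G →ₗ[R] Cohomology 𝔞 q G)) := by
      intro x hx
      obtain ⟨n, hn⟩ := h x hx
      exact ⟨n, isArtinian_range_smul_of_exact (β := e.toLinearMap) (δ := (0 : _ →ₗ[R] PUnit))
        (fun y => ⟨fun _ => e.surjective y, fun _ => rfl⟩) _⟩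
    suffices IsArtinian R (Cohomology 𝔞 q G) from isArtinian_of_linearEquiv e.symm
    obtain ⟨y, hy, hyinj⟩ := exists_injective_smul_quotient_powTorsion 𝔞 (hN (powTorsion 𝔞 N))
    obtain ⟨n, hn⟩ := hP y hy
    obtain ⟨x, hx⟩ : ∃ x, y ^ n = x := ⟨_, rfl⟩
    have hxinj : Function.Injective (x • LinearMap.id : G →ₗ[R] G) := by
      have hyreg : IsSMulRegular G y := fun a b hab => hyinj hab
      exact fun a b hab => hyreg.pow n (hx ▸ hab)
    rw [hx] at hn
    have hg := Submodule.mkQ_surjective (LinearMap.range (x • LinearMap.id : G →ₗ[R] G))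
    have hfg := LinearMap.exact_map_mkQ_range (x • LinearMap.id : G →ₗ[R] G)
    have hex := exact_cohomologyMap 𝔞 q hxinj hg hfg
    rw [cohomologyMap_smul_id] at hex
    obtain ⟨δ, hδ, _⟩ := exists_connectingMap 𝔞 q hxinj hg hfg
    have := h_artG (q + 1) (Nat.lt_succ_self q)
    have : IsArtinian R
        (Cohomology 𝔞 q (G ⧸ LinearMap.range (x • LinearMap.id : G →ₗ[R] G))) := by
      refine ih (associatedPrimes_finite_of_surjective hG hg)
        (krullDim_support_quotient_lt hxinj (lt_of_le_of_lt ?_ hd)) (fun i hi => ?_)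
        (fun z hz => ?_)
      · exact Module.supportDim_le_of_surjective _ (powTorsion 𝔞 N).mkQ_surjective
      · obtain ⟨δ, hδ, _⟩ := exists_connectingMap 𝔞 i hxinj hg hfg
        have := h_artG i hi
        have := h_artG (i + 1) (hi.trans (Nat.lt_succ_self i))
        exact isArtinian_of_exact hδ
      · obtain ⟨m, hm⟩ := hP z hz
        exact ⟨m, isArtinian_range_smul_of_exact hδ _⟩
    exact isArtinian_of_exact_of_isArtinian_range hex

end localCohomology

theorem top_nonartinian_localCohomology_not_finite
    {R : Type u} [CommRing R] [IsNoetherianRing R]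
    (𝔞 : Ideal R) (N : Type u) [AddCommGroup N] [Module R N]
    (h_wl : ∀ N' : Submodule R N, (associatedPrimes R (N ⧸ N')).Finite)
    (h_dim : Order.krullDim ↥(Module.support R N) ≠ ⊤)
    (q : ℕ) (h_pos : 0 < q)
    (h_not_art : ¬ IsArtinian R ((localCohomology 𝔞 q).obj (ModuleCat.of R N)))
    (h_art : ∀ i, q < i → IsArtinian R ((localCohomology 𝔞 i).obj (ModuleCat.of R N))) :
    ¬ Module.Finite R ((localCohomology 𝔞 q).obj (ModuleCat.of R N)) := by
  intro h_fin
  let e (i : ℕ) : (localCohomology 𝔞 i).obj (ModuleCat.of R N) ≃ₗ[R]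
      localCohomology.Cohomology 𝔞 i N :=
    (localCohomology.homologyIso 𝔞 (ModuleCat.of R N) i).toLinearEquiv
  obtain ⟨d, hd⟩ : ∃ d : ℕ, Order.krullDim (Module.support R N) < (d : ℕ) := by
    generalize Order.krullDim (Module.support R N) = k at h_dim ⊢
    induction k with
    | bot => exact ⟨0, WithBot.bot_lt_coe _⟩
    | coe k =>
      obtain ⟨k, rfl⟩ := ENat.ne_top_iff_exists.1 fun h => h_dim (congrArg _ h)
      exact ⟨k + 1, WithBot.coe_lt_coe.2 (Nat.cast_lt.2 (Nat.lt_succ_self k))⟩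
  have : Module.Finite R (localCohomology.Cohomology 𝔞 q N) := Module.Finite.equiv (e q)
  obtain ⟨n, hn⟩ := localCohomology.exists_pow_smul_eq_zero_of_fg 𝔞
    (localCohomology.powTorsion_cohomology 𝔞 q N) Module.Finite.fg_top
  refine h_not_art ?_
  have := localCohomology.isArtinian_cohomology 𝔞 h_pos d h_wl hd
    (fun i hi => by
      have := h_art i hi
      exact isArtinian_of_linearEquiv (e i))
    (fun x hx => ⟨n, by
      have h₀ : (x ^ n • LinearMap.id : localCohomology.Cohomology 𝔞 q N →ₗ[R] _) = 0 :=
        LinearMap.ext fun y => hn _ (Ideal.pow_mem_pow hx n) y trivial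
      rw [h₀, LinearMap.range_zero]
      infer_instance⟩)
  exact isArtinian_of_linearEquiv (e q).symm
end

section
/- Let R be a commutative Noetherian ring, 𝔞 an ideal of R, and N a finitely generated R-module of finite dimension. If q_𝔞(N) > 0, then f_𝔞(N) ≤ q_𝔞(N); that is, if q is a positive integer such that H^q_𝔞(N) is not Artinian while H^i_𝔞(N) is Artinian for all i > q, then there exists an integer i ≤ q such that H^i_𝔞(N) is not finitely generated. -/
/-!
# Finiteness and Artinianness dimensions of local cohomology

Local cohomology in positive degrees is identified with the direct limit `ExtColimit` of the modules
`Ext (R ⧸ 𝔞 ^ n) N i`, where long exact sequences are available. If these modules are Artinian above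
a positive degree `q` and powers of each element of `𝔞` act on the `q`-th one with Artinian image,
then the `q`-th one is Artinian; this applies in particular when the `q`-th one is finitely
generated.
-/

open CategoryTheory Opposite

universe u v w

section Comparison

variable {R : Type u} [CommRing R]

namespace CochainComplex

/-- The element of `K.cycles n` given by an element of the kernel of the differential. -/
noncomputable def cyclesMkₗ (K : CochainComplex (ModuleCat.{u} R) ℕ) (n : ℕ) :
    LinearMap.ker (K.d n (n + 1)).hom →ₗ[R] K.cycles n :=
  (K.sc n).moduleCatCyclesIso.inv.hom ∘ₗ
    Submodule.inclusion (p' := LinearMap.ker (K.sc n).g.hom) (fun f hf => by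
      change K.d n ((ComplexShape.up ℕ).next n) f = 0
      rw [CochainComplex.next]
      exact hf)

lemma iCycles_cyclesMkₗ (K : CochainComplex (ModuleCat.{u} R) ℕ) (n : ℕ)
    (f : LinearMap.ker (K.d n (n + 1)).hom) : K.iCycles n (cyclesMkₗ K n f) = f.1 :=
  congr($((K.sc n).moduleCatCyclesIso_inv_iCycles) (Submodule.inclusion _ f))

lemma iCycles_injective (K : CochainComplex (ModuleCat.{u} R) ℕ) (n : ℕ) :
    Function.Injective (K.iCycles n) :=
  (ModuleCat.mono_iff_injective _).mp inferInstance

/-- The homology class of an element of the kernel of the differential. -/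
noncomputable def homologyMkₗ (K : CochainComplex (ModuleCat.{u} R) ℕ) (n : ℕ) :
    LinearMap.ker (K.d n (n + 1)).hom →ₗ[R] K.homology n :=
  (K.homologyπ n).hom ∘ₗ cyclesMkₗ K n

lemma homologyMkₗ_surjective (K : CochainComplex (ModuleCat.{u} R) ℕ) (n : ℕ) :
    Function.Surjective (homologyMkₗ K n) := by
  intro x
  obtain ⟨z, rfl⟩ := (ModuleCat.epi_iff_surjective (K.homologyπ n)).mp inferInstance x
  refine ⟨⟨K.iCycles n z, ?_⟩, congrArg (K.homologyπ n) (iCycles_injective K n ?_)⟩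
  · have := K.iCycles_d n (n + 1)
    exact congr($this z)
  · exact iCycles_cyclesMkₗ _ _ _

lemma homologyMkₗ_eq_zero_iff (K : CochainComplex (ModuleCat.{u} R) ℕ) (n : ℕ)
    (f : LinearMap.ker (K.d (n + 1) (n + 1 + 1)).hom) :
    homologyMkₗ K (n + 1) f = 0 ↔ ∃ g, K.d n (n + 1) g = f.1 := by
  have hex := (ShortComplex.ShortExact.moduleCat_exact_iff_function_exact _).mp
    (ShortComplex.exact_of_g_is_cokernel
      (ShortComplex.mk (K.toCycles n (n + 1)) (K.homologyπ (n + 1)) (by simp))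
      (K.homologyIsCokernel n (n + 1) (by simp)))
  refine (hex (cyclesMkₗ K (n + 1) f)).trans ⟨?_, ?_⟩
  · rintro ⟨g, hg⟩
    refine ⟨g, ?_⟩
    rw [← iCycles_cyclesMkₗ, ← hg]
    exact congr($(K.toCycles_i n (n + 1)) g).symm
  · rintro ⟨g, hg⟩
    refine ⟨g, iCycles_injective K (n + 1) ?_⟩
    rw [iCycles_cyclesMkₗ, ← hg]
    exact congr($(K.toCycles_i n (n + 1)) g)

lemma homologyMap_homologyMkₗ {K L : CochainComplex (ModuleCat.{u} R) ℕ} (φ : K ⟶ L) (n : ℕ)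
    (f : LinearMap.ker (K.d n (n + 1)).hom) (f' : LinearMap.ker (L.d n (n + 1)).hom)
    (h : φ.f n f.1 = f'.1) :
    HomologicalComplex.homologyMap φ n (homologyMkₗ K n f) = homologyMkₗ L n f' := by
  have h₁ : HomologicalComplex.cyclesMap φ n (cyclesMkₗ K n f) = cyclesMkₗ L n f' := by
    apply iCycles_injective
    rw [iCycles_cyclesMkₗ, ← h, ← iCycles_cyclesMkₗ K n f]
    exact congr($(HomologicalComplex.cyclesMap_i φ n) (cyclesMkₗ K n f))
  refine Eq.trans ?_ (congrArg (L.homologyπ n) h₁)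
  exact congr($(HomologicalComplex.homologyπ_naturality φ n) (cyclesMkₗ K n f))

end CochainComplex

variable {C : Type v} [Category.{u} C] [Abelian C] [Linear R C]
  [EnoughProjectives C]

namespace CategoryTheory.ProjectiveResolution

/-- The map induced by a chain map on the cochain complexes of morphisms to `Y`. -/
noncomputable def dualMap {P Q : ChainComplex C ℕ} (φ : P ⟶ Q) (Y : C) :
    Q.linearYonedaObj R Y ⟶ P.linearYonedaObj R Y :=
  (HomologicalComplex.unopFunctor (ModuleCat.{u} R) (ComplexShape.up ℕ).symm).map
    ((((linearYoneda R C).obj Y).rightOp.mapHomologicalComplex _).map φ).op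

lemma symm_trans_hom_comp {D : Type*} [Category D] {A A' B B' E E' : D} (a : B ≅ A) (a' : B' ≅ A')
    (u : E ≅ B) (u' : E' ≅ B') (m : B' ⟶ B) (e : A' ⟶ A) (d : E' ⟶ E)
    (h₁ : e ≫ a.inv = a'.inv ≫ m) (h₂ : d ≫ u.hom = u'.hom ≫ m) :
    (a'.symm ≪≫ u'.symm).hom ≫ d = e ≫ (a.symm ≪≫ u.symm).hom := by
  have h₃ : u'.inv ≫ d = m ≫ u.inv := by
    rw [Iso.inv_comp_eq, ← Category.assoc, ← h₂]; simp
  simp [h₃, reassoc_of% h₁]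

lemma inv_comp_eq_comp_inv {D : Type*} [Category D] {A A' B B' : D} (a : A ≅ B) (b : A' ≅ B')
    (e : A ⟶ A') (d : B ⟶ B') (h : e ≫ b.hom = a.hom ≫ d) : a.inv ≫ e = d ≫ b.inv := by
  rw [Iso.inv_comp_eq, ← Category.assoc, ← h]; simp

lemma isoExt_naturality {X X' : C} (P : ProjectiveResolution X) (P' : ProjectiveResolution X')
    (f : X ⟶ X') (φ : P.complex ⟶ P'.complex) (comm : φ.f 0 ≫ P'.π.f 0 = P.π.f 0 ≫ f)
    (n : ℕ) (Y : C) :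
    (P'.isoExt (R := R) n Y).hom ≫ HomologicalComplex.homologyMap (dualMap φ Y) n =
      ((Ext R C n).map f.op).app Y ≫ (P.isoExt n Y).hom := by
  have h₁ := isoLeftDerivedObj_inv_naturality f P P' φ comm ((linearYoneda R C).obj Y).rightOp n
  have h₂ := HomologicalComplex.homologyOp_hom_naturality (dualMap (R := R) φ Y) n
  exact symm_trans_hom_comp (P.isoLeftDerivedObj ((linearYoneda R C).obj Y).rightOp n).unop
    (P'.isoLeftDerivedObj ((linearYoneda R C).obj Y).rightOp n).unop
    (HomologicalComplex.homologyUnop _ n) (HomologicalComplex.homologyUnop _ n)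
    (((((linearYoneda R C).obj Y).rightOp.mapHomologicalComplex _ ⋙
        HomologicalComplex.homologyFunctor _ _ n).map φ).unop)
    (((((linearYoneda R C).obj Y).rightOp.leftDerived n).map f).unop)
    (HomologicalComplex.homologyMap (dualMap φ Y) n)
    (congrArg Quiver.Hom.unop h₁) (congrArg Quiver.Hom.unop h₂.symm)

variable {X X' : C} (P' : ProjectiveResolution X') (P : ProjectiveResolution X)

/-- The cocycles of degree `n` computing `Ext X Y n`. -/
abbrev cocycles (R : Type u) [CommRing R] [Linear R C] (n : ℕ) (Y : C) :=
  LinearMap.ker ((P.complex.linearYonedaObj R Y).d n (n + 1)).hom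

/-- The class of a cocycle, in the derived functor model of `Ext`. -/
noncomputable def derivedExtMkₗ (n : ℕ) (Y : C) :
    P.cocycles R n Y →ₗ[R] ((Ext R C n).obj (op X)).obj Y :=
  (P.isoExt n Y).inv.hom ∘ₗ CochainComplex.homologyMkₗ (P.complex.linearYonedaObj R Y) n

lemma derivedExtMkₗ_surjective (n : ℕ) (Y : C) :
    Function.Surjective (P.derivedExtMkₗ (R := R) n Y) :=
  ((ModuleCat.epi_iff_surjective (P.isoExt (R := R) n Y).inv).mp inferInstance).comp
    (CochainComplex.homologyMkₗ_surjective _ n)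

lemma derivedExtMkₗ_eq_zero_iff (n : ℕ) (Y : C) (f : P.cocycles R (n + 1) Y) :
    P.derivedExtMkₗ (n + 1) Y f = 0 ↔
      ∃ g : P.complex.X n ⟶ Y, P.complex.d (n + 1) n ≫ g = f.1 := by
  refine Iff.trans ?_ (CochainComplex.homologyMkₗ_eq_zero_iff _ n f)
  exact map_eq_zero_iff (P.isoExt (R := R) (n + 1) Y).inv.hom
    ((ModuleCat.mono_iff_injective (P.isoExt (R := R) (n + 1) Y).inv).mp inferInstance)

variable {P P'} in
lemma map_derivedExtMkₗ {f : X ⟶ X'} (φ : Hom P P' f) (n : ℕ) (Y : C) (x : P'.cocycles R n Y)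
    (y : P.cocycles R n Y) (h : φ.hom.f n ≫ x.1 = y.1) :
    ((Ext R C n).map f.op).app Y (P'.derivedExtMkₗ n Y x) = P.derivedExtMkₗ n Y y := by
  have h₁ := isoExt_naturality (R := R) P P' f φ.hom
    (φ.hom_f_zero_comp_π_f_zero.trans (congrArg (P.π.f 0 ≫ ·) (by simp))) n Y
  have h₂ := CochainComplex.homologyMap_homologyMkₗ (dualMap (R := R) φ.hom Y) n x y h
  refine congr($(inv_comp_eq_comp_inv _ _ _ _ h₁.symm) (CochainComplex.homologyMkₗ _ n x)).trans ?_
  exact congrArg (P.isoExt (R := R) n Y).inv h₂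

variable [HasExt.{u} C]

/-- The class of a cocycle, in the derived category model of `Ext`. -/
noncomputable def extMkₗ (n : ℕ) (Y : C) : P.cocycles R n Y →ₗ[R] Abelian.Ext X Y n where
  toFun f := P.extMk f.1 (n + 1) rfl f.2
  map_add' f g := (P.add_extMk _ _ _ _ _ _).symm
  map_smul' r f := by
    have := P.extMk_comp_mk₀ f.1 (n + 1) rfl f.2 (r • 𝟙 Y)
    rw [RingHom.id_apply, Abelian.Ext.smul_eq_comp_mk₀, this]
    congr 1
    exact ((Linear.comp_smul _ _ _ _ _ _).trans (congrArg (r • ·) (Category.comp_id _))).symm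

omit [EnoughProjectives C] in
lemma extMkₗ_surjective (n : ℕ) (Y : C) : Function.Surjective (P.extMkₗ (R := R) n Y) := by
  intro x
  obtain ⟨f, hf, rfl⟩ := P.extMk_surjective x (n + 1) rfl
  exact ⟨⟨f, hf⟩, rfl⟩

lemma ker_extMkₗ (n : ℕ) (Y : C) :
    LinearMap.ker (P.extMkₗ (R := R) (n + 1) Y) =
      LinearMap.ker (P.derivedExtMkₗ (R := R) (n + 1) Y) := by
  ext f
  rw [LinearMap.mem_ker, LinearMap.mem_ker, derivedExtMkₗ_eq_zero_iff]
  exact P.extMk_eq_zero_iff f.1 _ rfl f.2 n rfl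

/-- The comparison between the two models of `Ext` in positive degrees. -/
noncomputable def extEquivDerivedExt (n : ℕ) (Y : C) :
    Abelian.Ext X Y (n + 1) ≃ₗ[R] ((Ext R C (n + 1)).obj (op X)).obj Y :=
  ((P.extMkₗ (n + 1) Y).quotKerEquivOfSurjective (P.extMkₗ_surjective _ Y)).symm ≪≫ₗ
    Submodule.quotEquivOfEq _ _ (P.ker_extMkₗ n Y) ≪≫ₗ
    (P.derivedExtMkₗ (n + 1) Y).quotKerEquivOfSurjective (P.derivedExtMkₗ_surjective _ Y)

lemma extEquivDerivedExt_extMkₗ (n : ℕ) (Y : C) (f : P.cocycles R (n + 1) Y) :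
    P.extEquivDerivedExt n Y (P.extMkₗ (n + 1) Y f) = P.derivedExtMkₗ (n + 1) Y f := by
  have h : ((P.extMkₗ (n + 1) Y).quotKerEquivOfSurjective (P.extMkₗ_surjective _ Y)).symm
      (P.extMkₗ (n + 1) Y f) = Submodule.Quotient.mk f := by
    rw [LinearEquiv.symm_apply_eq]; rfl
  simp only [extEquivDerivedExt, LinearEquiv.trans_apply, h]
  rfl

lemma map_extEquivDerivedExt (f : X ⟶ X') (n : ℕ) (Y : C) (x : Abelian.Ext X' Y (n + 1)) :
    ((Ext R C (n + 1)).map f.op).app Y (P'.extEquivDerivedExt n Y x) =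
      P.extEquivDerivedExt n Y ((Abelian.Ext.mk₀ f).comp x (zero_add _)) := by
  obtain ⟨c, rfl⟩ := P'.extMkₗ_surjective (R := R) _ _ x
  let φ : Hom P P' f := ⟨lift f P P',
    (lift_commutes_zero f P P').trans (congrArg (P.π.f 0 ≫ ·) (by simp))⟩
  have h₁ := mk₀_comp_extMk c.1 (n + 1 + 1) rfl c.2 φ
  let c' : P.cocycles R (n + 1) Y := ⟨φ.hom.f (n + 1) ≫ c.1, by
    have key : ∀ g : P'.complex.X (n + 1) ⟶ Y, P'.complex.d (n + 1 + 1) (n + 1) ≫ g = 0 →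
        P.complex.d (n + 1 + 1) (n + 1) ≫ φ.hom.f (n + 1) ≫ g = 0 := fun g h => by
      rw [← Category.assoc, ← φ.hom.comm, Category.assoc, h, Limits.comp_zero]
    exact key c.1 c.2⟩
  rw [extEquivDerivedExt_extMkₗ, map_derivedExtMkₗ φ _ _ c c' rfl, ← extEquivDerivedExt_extMkₗ]
  exact congrArg _ h₁.symm

end CategoryTheory.ProjectiveResolution

end Comparison

section ExtColimit

open Abelian

variable {R : Type u} [CommRing R] (𝔞 : Ideal R)

/-- The projection `R ⧸ 𝔞 ^ n ⟶ R ⧸ 𝔞 ^ m` for `m ≤ n`. -/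
noncomputable def quotientPowMap {m n : ℕ} (h : m ≤ n) :
    ModuleCat.of R (R ⧸ 𝔞 ^ n) ⟶ ModuleCat.of R (R ⧸ 𝔞 ^ m) :=
  ModuleCat.ofHom (Submodule.mapQ _ _ LinearMap.id (Ideal.pow_le_pow_right h))

/-- The transition maps of the direct system `Ext (R ⧸ 𝔞 ^ n) N i`. -/
noncomputable def extTransition (N : ModuleCat.{u} R) (i m n : ℕ) (h : m ≤ n) :
    Ext (ModuleCat.of R (R ⧸ 𝔞 ^ m)) N i →ₗ[R] Ext (ModuleCat.of R (R ⧸ 𝔞 ^ n)) N i :=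
  (Ext.mk₀ (quotientPowMap 𝔞 h)).precompOfLinear R N (zero_add i)

lemma extTransition_apply (N : ModuleCat.{u} R) (i m n : ℕ) (h : m ≤ n)
    (x : Ext (ModuleCat.of R (R ⧸ 𝔞 ^ m)) N i) :
    extTransition 𝔞 N i m n h x = (Ext.mk₀ (quotientPowMap 𝔞 h)).comp x (zero_add i) := rfl

instance (N : ModuleCat.{u} R) (i : ℕ) :
    DirectedSystem (fun n => Ext (ModuleCat.of R (R ⧸ 𝔞 ^ n)) N i)
      (fun m n h => extTransition 𝔞 N i m n h) where
  map_self n x := by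
    have : quotientPowMap 𝔞 (le_refl n) = 𝟙 _ := by
      ext; rfl
    rw [extTransition_apply, this, Ext.mk₀_id_comp]
  map_map l m n h₁ h₂ x := by
    have : quotientPowMap 𝔞 h₂ ≫ quotientPowMap 𝔞 h₁ = quotientPowMap 𝔞 (h₁.trans h₂) := by
      ext; rfl
    rw [extTransition_apply, extTransition_apply, extTransition_apply, ← this,
      Ext.mk₀_comp_mk₀_assoc]

/-- The local cohomology of `N`, as the direct limit of the modules `Ext (R ⧸ 𝔞 ^ n) N i`. -/
def ExtColimit (N : ModuleCat.{u} R) (i : ℕ) : Type u :=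
  Module.DirectLimit (fun n => Ext (ModuleCat.of R (R ⧸ 𝔞 ^ n)) N i) (extTransition 𝔞 N i)

noncomputable instance (N : ModuleCat.{u} R) (i : ℕ) : AddCommGroup (ExtColimit 𝔞 N i) :=
  inferInstanceAs (AddCommGroup (Module.DirectLimit _ (extTransition 𝔞 N i)))

noncomputable instance (N : ModuleCat.{u} R) (i : ℕ) : Module R (ExtColimit 𝔞 N i) :=
  inferInstanceAs (Module R (Module.DirectLimit _ (extTransition 𝔞 N i)))

namespace ExtColimit

variable {𝔞}

/-- The structure map from a term of the direct system. -/
noncomputable def of (N : ModuleCat.{u} R) (i n : ℕ) :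
    Ext (ModuleCat.of R (R ⧸ 𝔞 ^ n)) N i →ₗ[R] ExtColimit 𝔞 N i :=
  Module.DirectLimit.of R ℕ (fun n => Ext (ModuleCat.of R (R ⧸ 𝔞 ^ n)) N i)
    (extTransition 𝔞 N i) n

lemma exists_of {N : ModuleCat.{u} R} {i : ℕ} (x : ExtColimit 𝔞 N i) :
    ∃ n y, of N i n y = x :=
  Module.DirectLimit.exists_of x

lemma of_comp {N : ModuleCat.{u} R} {i m n : ℕ} (h : m ≤ n)
    (x : Ext (ModuleCat.of R (R ⧸ 𝔞 ^ m)) N i) :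
    of N i n ((Ext.mk₀ (quotientPowMap 𝔞 h)).comp x (zero_add i)) = of N i m x :=
  Module.DirectLimit.of_f (f := extTransition 𝔞 N i) (hij := h)

lemma exists_comp_eq_zero {N : ModuleCat.{u} R} {i n : ℕ}
    {x : Ext (ModuleCat.of R (R ⧸ 𝔞 ^ n)) N i} (h : of N i n x = 0) :
    ∃ m, ∃ hm : n ≤ m, (Ext.mk₀ (quotientPowMap 𝔞 hm)).comp x (zero_add i) = 0 :=
  Module.DirectLimit.of.zero_exact h

/-- The map on `ExtColimit` given by composition with an extension class. -/
noncomputable def postcomp {N N' : ModuleCat.{u} R} {j : ℕ} (α : Ext N N' j) {i k : ℕ}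
    (h : i + j = k) : ExtColimit 𝔞 N i →ₗ[R] ExtColimit 𝔞 N' k :=
  Module.DirectLimit.map (fun _ => α.postcompOfLinear R _ h) (fun m n hmn => by
    ext x
    exact Ext.comp_assoc _ _ _ (zero_add i) h (by lia))

lemma postcomp_of {N N' : ModuleCat.{u} R} {j : ℕ} (α : Ext N N' j) {i k : ℕ}
    (h : i + j = k) (n : ℕ) (x : Ext (ModuleCat.of R (R ⧸ 𝔞 ^ n)) N i) :
    postcomp α h (of N i n x) = of N' k n (x.comp α h) :=
  Module.DirectLimit.map_apply_of _ _ _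

lemma range_postcomp_eq_ker {N₁ N₂ N₃ : ModuleCat.{u} R} {j l : ℕ} (α : Ext N₁ N₂ j)
    (β : Ext N₂ N₃ l) {i₁ i₂ i₃ : ℕ} (h : i₁ + j = i₂) (h' : i₂ + l = i₃)
    (hzero : α.comp β rfl = 0)
    (hexact : ∀ (X : ModuleCat.{u} R) (x : Ext X N₂ i₂), x.comp β h' = 0 →
      ∃ y : Ext X N₁ i₁, y.comp α h = x) :
    LinearMap.range (postcomp (𝔞 := 𝔞) α h) = LinearMap.ker (postcomp β h') := by
  ext x
  rw [LinearMap.mem_range, LinearMap.mem_ker]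
  constructor
  · rintro ⟨y, rfl⟩
    obtain ⟨n, y, rfl⟩ := exists_of y
    rw [postcomp_of, postcomp_of, Ext.comp_assoc _ _ _ h rfl (by lia), hzero, Ext.comp_zero,
      map_zero]
  · intro hx
    obtain ⟨n, x, rfl⟩ := exists_of x
    rw [postcomp_of] at hx
    obtain ⟨m, hm, hx⟩ := exists_comp_eq_zero hx
    rw [← Ext.comp_assoc _ _ _ (zero_add i₂) h' (by lia)] at hx
    obtain ⟨y, hy⟩ := hexact _ _ hx
    exact ⟨of _ _ m y, by rw [postcomp_of, hy, of_comp]⟩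

/-- Functoriality of `ExtColimit` in the module. -/
noncomputable abbrev map {N N' : ModuleCat.{u} R} (f : N ⟶ N') (i : ℕ) :
    ExtColimit 𝔞 N i →ₗ[R] ExtColimit 𝔞 N' i :=
  postcomp (Ext.mk₀ f) (add_zero i)

lemma map_smul_id (N : ModuleCat.{u} R) (i : ℕ) (r : R) (x : ExtColimit 𝔞 N i) :
    map (r • 𝟙 N) i x = r • x := by
  obtain ⟨n, x, rfl⟩ := exists_of x
  rw [postcomp_of, ← map_smul, Ext.smul_eq_comp_mk₀]

variable {S : ShortComplex (ModuleCat.{u} R)} (hS : S.ShortExact)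

/-- The connecting homomorphism. -/
noncomputable abbrev δ (i : ℕ) : ExtColimit 𝔞 S.X₃ i →ₗ[R] ExtColimit 𝔞 S.X₁ (i + 1) :=
  postcomp hS.extClass rfl

include hS in
lemma range_map_f (i : ℕ) :
    LinearMap.range (map (𝔞 := 𝔞) S.f i) = LinearMap.ker (map S.g i) :=
  range_postcomp_eq_ker _ _ _ _ (by simp) fun X x hx => Ext.covariant_sequence_exact₂ X hS x hx

lemma range_map_g (i : ℕ) :
    LinearMap.range (map (𝔞 := 𝔞) S.g i) = LinearMap.ker (δ hS i) :=
  range_postcomp_eq_ker _ _ _ _ (hS.comp_extClass)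
    fun X x hx => Ext.covariant_sequence_exact₃ X hS x rfl hx

lemma range_δ (i : ℕ) :
    LinearMap.range (δ (𝔞 := 𝔞) hS i) = LinearMap.ker (map S.f (i + 1)) :=
  range_postcomp_eq_ker _ _ _ _ (hS.extClass_comp)
    fun X x hx => Ext.covariant_sequence_exact₁ X hS x hx rfl

lemma subsingleton_of_ext {N : ModuleCat.{u} R} {i : ℕ}
    (h : ∀ (n : ℕ) (x : Ext (ModuleCat.of R (R ⧸ 𝔞 ^ n)) N i), of N i n x = 0) :
    Subsingleton (ExtColimit 𝔞 N i) :=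
  subsingleton_of_forall_eq 0 fun x => by
    obtain ⟨n, x, rfl⟩ := exists_of x
    exact h n x

lemma subsingleton_of_injective (N : ModuleCat.{u} R) [Injective N] (i : ℕ) :
    Subsingleton (ExtColimit 𝔞 N (i + 1)) :=
  subsingleton_of_ext fun n x => by rw [Ext.eq_zero_of_injective x, map_zero]

lemma subsingleton_of_isZero (N : ModuleCat.{u} R) (h : Limits.IsZero N) (i : ℕ) :
    Subsingleton (ExtColimit 𝔞 N i) :=
  subsingleton_of_ext fun n x => by
    have : x = x.comp (Ext.mk₀ (𝟙 N)) (add_zero i) := by simp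
    rw [this, h.eq_of_src (𝟙 N) 0]
    simp

/-- Every element of `ExtColimit` is annihilated by a power of `𝔞`. -/
lemma exists_pow_smul_eq_zero {N : ModuleCat.{u} R} {i : ℕ} (x : ExtColimit 𝔞 N i) :
    ∃ n, ∀ r ∈ 𝔞 ^ n, r • x = 0 := by
  obtain ⟨n, x, rfl⟩ := exists_of x
  refine ⟨n, fun r hr => ?_⟩
  have h : r • 𝟙 (ModuleCat.of R (R ⧸ 𝔞 ^ n)) = 0 := by
    ext
    exact (Algebra.smul_def r (1 : R ⧸ 𝔞 ^ n)).trans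
      ((mul_one _).trans (Ideal.Quotient.eq_zero_iff_mem.mpr hr))
  have h' : r • x = (Ext.mk₀ (r • 𝟙 _)).comp x (zero_add i) := by
    rw [Ext.mk₀_smul, Ext.smul_comp, Ext.mk₀_id_comp]
  rw [← map_smul, h', h, Ext.mk₀_zero, Ext.zero_comp, map_zero]

end ExtColimit

end ExtColimit

section LocalCohomologyComparison

open Abelian Limits

variable {R : Type u} [CommRing R] (𝔞 : Ideal R)

namespace ExtColimit

/-- The comparison map on a term of the direct system. -/
noncomputable def toLocalCohomologyAux (i : ℕ) (N : ModuleCat.{u} R) (n : ℕ) :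
    Ext (ModuleCat.of R (R ⧸ 𝔞 ^ n)) N (i + 1) →ₗ[R] (localCohomology 𝔞 (i + 1)).obj N :=
  ((colimit.ι (localCohomology.diagram (localCohomology.idealPowersDiagram 𝔞) (i + 1))
      (op (op n))).app N).hom ∘ₗ
    ((projectiveResolution (ModuleCat.of R (R ⧸ 𝔞 ^ n))).extEquivDerivedExt i N).toLinearMap

lemma map_diagram (i : ℕ) (N : ModuleCat.{u} R) {m n : ℕ} (h : m ≤ n)
    (f : (op (op m) : ℕᵒᵖᵒᵖ) ⟶ op (op n)) (x : Ext (ModuleCat.of R (R ⧸ 𝔞 ^ m)) N (i + 1)) :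
    ((localCohomology.diagram (localCohomology.idealPowersDiagram 𝔞) (i + 1)).map f).app N
      ((projectiveResolution (ModuleCat.of R (R ⧸ 𝔞 ^ m))).extEquivDerivedExt i N x) =
    (projectiveResolution (ModuleCat.of R (R ⧸ 𝔞 ^ n))).extEquivDerivedExt i N
      (extTransition 𝔞 N (i + 1) m n h x) :=
  ProjectiveResolution.map_extEquivDerivedExt _ _ (quotientPowMap 𝔞 h) i N x

/-- The comparison map to local cohomology in positive degrees. -/
noncomputable def toLocalCohomology (i : ℕ) (N : ModuleCat.{u} R) :
    ExtColimit 𝔞 N (i + 1) →ₗ[R] (localCohomology 𝔞 (i + 1)).obj N :=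
  Module.DirectLimit.lift R ℕ _ _ (toLocalCohomologyAux 𝔞 i N) fun m n h x => by
    have h₁ := map_diagram 𝔞 i N h (homOfLE h).op.op x
    refine (congrArg _ h₁.symm).trans ?_
    exact congr(($(colimit.w (localCohomology.diagram (localCohomology.idealPowersDiagram 𝔞)
      (i + 1)) (homOfLE h).op.op).app N) _)

lemma toLocalCohomology_of (i : ℕ) (N : ModuleCat.{u} R) (n : ℕ)
    (x : Ext (ModuleCat.of R (R ⧸ 𝔞 ^ n)) N (i + 1)) :
    toLocalCohomology 𝔞 i N (of N (i + 1) n x) = toLocalCohomologyAux 𝔞 i N n x :=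
  Module.DirectLimit.lift_of _ _ _

lemma toLocalCohomology_bijective (i : ℕ) (N : ModuleCat.{u} R) :
    Function.Bijective (toLocalCohomology 𝔞 i N) := by
  have hc := isColimitOfPreserves ((evaluation _ _).obj N) (colimit.isColimit
    (localCohomology.diagram (localCohomology.idealPowersDiagram 𝔞) (i + 1)))
  have : PreservesFilteredColimitsOfSize.{0, 0} (forget (ModuleCat.{u} R)) :=
    preservesFilteredColimitsOfSize_shrink.{0, u, 0, u} _
  have : PreservesColimitsOfShape ℕᵒᵖᵒᵖ (forget (ModuleCat.{u} R)) :=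
    PreservesFilteredColimitsOfSize.preserves_filtered_colimits _
  constructor
  · rw [injective_iff_map_eq_zero]
    intro x hx
    obtain ⟨n, x, rfl⟩ := exists_of x
    rw [toLocalCohomology_of] at hx
    obtain ⟨⟨⟨m⟩⟩, f, g, hfg⟩ := Concrete.isColimit_exists_of_rep_eq _ hc (i := op (op n))
      (j := op (op n))
      ((projectiveResolution (ModuleCat.of R (R ⧸ 𝔞 ^ n))).extEquivDerivedExt i N x) 0
      (hx.trans (map_zero _).symm)
    have hnm : n ≤ m := leOfHom f.unop.unop
    have h₁ : (projectiveResolution (ModuleCat.of R (R ⧸ 𝔞 ^ m))).extEquivDerivedExt i N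
        (extTransition 𝔞 N (i + 1) n m hnm x) = 0 :=
      (map_diagram 𝔞 i N hnm f x).symm.trans (hfg.trans (map_zero _))
    rw [← of_comp hnm, ← extTransition_apply, (LinearEquiv.map_eq_zero_iff _).mp h₁, map_zero]
  · intro y
    obtain ⟨⟨⟨n⟩⟩, y, rfl⟩ := Concrete.isColimit_exists_rep _ hc y
    refine ⟨of N (i + 1) n
      (((projectiveResolution (ModuleCat.of R (R ⧸ 𝔞 ^ n))).extEquivDerivedExt i N).symm y), ?_⟩
    rw [toLocalCohomology_of]
    refine congrArg (((colimit.ι (localCohomology.diagram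
      (localCohomology.idealPowersDiagram 𝔞) (i + 1)) (op (op n))).app N)) ?_
    exact LinearEquiv.apply_symm_apply _ _

/-- The comparison isomorphism with local cohomology in positive degrees. -/
noncomputable def equivLocalCohomology (i : ℕ) (N : ModuleCat.{u} R) :
    ExtColimit 𝔞 N (i + 1) ≃ₗ[R] (localCohomology 𝔞 (i + 1)).obj N :=
  LinearEquiv.ofBijective _ (toLocalCohomology_bijective 𝔞 i N)

end ExtColimit

end LocalCohomologyComparison

section PowTorsion

variable {R : Type u} [CommRing R] (𝔞 : Ideal R)

/-- The submodule of elements annihilated by a power of `𝔞`. -/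
def powTorsion (M : Type v) [AddCommGroup M] [Module R M] : Submodule R M where
  carrier := {m | ∃ n, ∀ r ∈ 𝔞 ^ n, r • m = 0}
  zero_mem' := ⟨0, fun r _ => smul_zero r⟩
  add_mem' := by
    rintro a b ⟨m, hm⟩ ⟨n, hn⟩
    refine ⟨m + n, fun r hr => ?_⟩
    rw [smul_add, hm r (Ideal.pow_le_pow_right (Nat.le_add_right m n) hr),
      hn r (Ideal.pow_le_pow_right (Nat.le_add_left n m) hr), add_zero]
  smul_mem' := by
    rintro c a ⟨m, hm⟩
    exact ⟨m, fun r hr => by rw [smul_comm, hm r hr, smul_zero]⟩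

variable {𝔞} {M : Type v} [AddCommGroup M] [Module R M]

lemma powTorsion_eq_top_of_surjective {N : Type w} [AddCommGroup N] [Module R N] (f : M →ₗ[R] N)
    (hf : Function.Surjective f) (h : powTorsion 𝔞 M = ⊤) : powTorsion 𝔞 N = ⊤ := by
  rw [Submodule.eq_top_iff'] at h ⊢
  intro x
  obtain ⟨m, rfl⟩ := hf x
  obtain ⟨n, hn⟩ := h m
  exact ⟨n, fun r hr => by rw [← map_smul, hn r hr, map_zero]⟩

lemma powTorsion_powTorsion : powTorsion 𝔞 (powTorsion 𝔞 M) = ⊤ := by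
  rw [Submodule.eq_top_iff']
  rintro ⟨m, n, hn⟩
  exact ⟨n, fun r hr => Subtype.ext (hn r hr)⟩

/-- A finitely generated submodule of the torsion submodule is annihilated by a single power. -/
lemma exists_pow_smul_eq_zero_of_fg {K : Submodule R M} (hK : K.FG) (h : K ≤ powTorsion 𝔞 M) :
    ∃ n, ∀ r ∈ 𝔞 ^ n, ∀ m ∈ K, r • m = 0 := by
  induction K, hK using Submodule.fg_induction with
  | singleton x =>
    obtain ⟨n, hn⟩ := h (Submodule.mem_span_singleton_self x)
    refine ⟨n, fun r hr m hm => ?_⟩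
    obtain ⟨c, rfl⟩ := Submodule.mem_span_singleton.mp hm
    rw [smul_comm, hn r hr, smul_zero]
  | sup K₁ K₂ _ _ h₁ h₂ =>
    obtain ⟨n₁, h₁⟩ := h₁ (le_sup_left.trans h)
    obtain ⟨n₂, h₂⟩ := h₂ (le_sup_right.trans h)
    refine ⟨n₁ + n₂, fun r hr m hm => ?_⟩
    obtain ⟨a, ha, b, hb, rfl⟩ := Submodule.mem_sup.mp hm
    rw [smul_add, h₁ r (Ideal.pow_le_pow_right (Nat.le_add_right n₁ n₂) hr) a ha,
      h₂ r (Ideal.pow_le_pow_right (Nat.le_add_left n₂ n₁) hr) b hb, add_zero]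

/-- Over a Noetherian ring, the torsion submodule of an injective module is injective. -/
lemma baer_powTorsion [IsNoetherianRing R] (hM : Module.Baer R M) :
    Module.Baer R (powTorsion 𝔞 M) := by
  intro I g
  let g₀ : I →ₗ[R] M := (powTorsion 𝔞 M).subtype ∘ₗ g
  obtain ⟨m, hm⟩ := exists_pow_smul_eq_zero_of_fg (𝔞 := 𝔞) (K := LinearMap.range g₀)
    (LinearMap.range_eq_map g₀ ▸ Module.Finite.fg_top.map g₀)
    (by rintro _ ⟨x, rfl⟩; exact (g x).2)
  obtain ⟨k, hk⟩ := Ideal.exists_pow_inf_eq_pow_smul 𝔞 (M := R) I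
  have hle : I ⊓ 𝔞 ^ (m + k) ≤ 𝔞 ^ m • I := by
    have h := hk (m + k) (Nat.le_add_left k m)
    rw [Nat.add_sub_cancel, Ideal.smul_eq_mul, Ideal.mul_top] at h
    rw [inf_comm, h]
    exact Submodule.smul_mono le_rfl inf_le_right
  have hzero : ∀ x : I, (x : R) ∈ 𝔞 ^ (m + k) → g₀ x = 0 := by
    have h : 𝔞 ^ m • I ≤ (LinearMap.ker g₀).map I.subtype := by
      rw [Submodule.smul_le]
      intro r hr x hx
      refine ⟨r • ⟨x, hx⟩, ?_, rfl⟩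
      rw [SetLike.mem_coe, LinearMap.mem_ker, map_smul, hm r hr _ ⟨_, rfl⟩]
    intro x hx
    obtain ⟨y, hy, hyx⟩ := h (hle ⟨x.2, hx⟩)
    rwa [Subtype.ext hyx] at hy
  let f₁ : R →ₗ.[R] M := ⟨I, g₀⟩
  let f₂ : R →ₗ.[R] M := ⟨𝔞 ^ (m + k), 0⟩
  have hcompat : ∀ (x : f₁.domain) (y : f₂.domain), (x : R) = y → f₁ x = f₂ y :=
    fun x y hxy => hzero x (hxy ▸ y.2)
  obtain ⟨h, hh⟩ := hM (f₁.sup f₂ hcompat).domain (f₁.sup f₂ hcompat).toFun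
  have h₁ : ∀ x : I, h x = g₀ x := fun x =>
    (hh x (f₁.left_le_sup f₂ hcompat |>.1 x.2)).trans
      ((f₁.left_le_sup f₂ hcompat).2 (x := x) (y := ⟨x, _⟩) rfl).symm
  have h₂ : ∀ r ∈ 𝔞 ^ (m + k), h r = 0 := fun r hr =>
    (hh r (f₁.right_le_sup f₂ hcompat |>.1 hr)).trans
      ((f₁.right_le_sup f₂ hcompat).2 (x := ⟨r, hr⟩) (y := ⟨r, _⟩) rfl).symm
  have h₃ : ∀ r, h r ∈ powTorsion 𝔞 M := fun r => ⟨m + k, fun s hs => by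
    rw [← map_smul]
    exact h₂ _ (Ideal.mul_mem_right r _ hs)⟩
  exact ⟨h.codRestrict _ h₃, fun x hx => Subtype.ext (h₁ ⟨x, hx⟩)⟩

lemma exists_mem_isSMulRegular [IsNoetherianRing R] [Module.Finite R M]
    (h : powTorsion 𝔞 M = ⊥) : ∃ x ∈ 𝔞, IsSMulRegular M x := by
  by_contra! hx
  have hsub : (𝔞 : Set R) ⊆ ⋃ p ∈ associatedPrimes R M, (p : Set R) := by
    rw [biUnion_associatedPrimes_eq_compl_regular]
    exact fun x hxa => hx x hxa
  obtain ⟨p, hp, hle⟩ := (Ideal.subset_union_prime_finite (associatedPrimes.finite R M) (f := id)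
    ⊥ ⊥ (fun p hp _ _ => hp.isPrime)).mp hsub
  obtain ⟨hprime, x, rfl⟩ := isAssociatedPrime_iff.mp hp
  have hx₀ : x ∈ powTorsion 𝔞 M := ⟨1, fun r hr => by
    simpa [Submodule.mem_colon_singleton] using hle (by simpa using hr)⟩
  rw [h, Submodule.mem_bot] at hx₀
  exact hprime.ne_top (by simp [hx₀])

/-- Noetherian induction on the quotients of a finitely generated module. -/
lemma ModuleCat.noetherian_quotient_induction [IsNoetherianRing R] {P : ModuleCat.{v} R → Prop}
    (h : ∀ (M : ModuleCat.{v} R) [Module.Finite R M],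
      (∀ K : Submodule R M, K ≠ ⊥ → P (ModuleCat.of R (M ⧸ K))) → P M)
    (N : ModuleCat.{v} R) [Module.Finite R N] : P N := by
  suffices H : ∀ (L : Submodule R N) (M : ModuleCat.{v} R) (f : N →ₗ[R] M),
      Function.Surjective f → LinearMap.ker f = L → P M from
    H _ N LinearMap.id Function.surjective_id rfl
  intro L
  induction L using WellFoundedGT.induction with
  | ind L ih =>
    intro M f hf hL
    have := Module.Finite.of_surjective f hf
    refine h M fun K hK => ih (K.comap f) ?_ _ (K.mkQ ∘ₗ f) (K.mkQ_surjective.comp hf) ?_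
    · rw [← hL]
      refine lt_of_le_of_ne (LinearMap.ker_le_comap f) fun heq => hK ?_
      rw [← Submodule.map_comap_eq_of_surjective hf K, ← heq]
      exact (Submodule.map_le_iff_le_comap.mpr le_rfl).antisymm bot_le
    · rw [LinearMap.ker_comp, Submodule.ker_mkQ]

/-- If `X → Y → Z` is exact and `Z` is Artinian, a map out of `Y` has Artinian range as soon as
its restriction to `X` does. -/
lemma isArtinian_range_of_exact {X Y Z W : Type*} [AddCommGroup X] [AddCommGroup Y]
    [AddCommGroup Z] [AddCommGroup W] [Module R X] [Module R Y] [Module R Z] [Module R W]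
    (β : X →ₗ[R] Y) (δ : Y →ₗ[R] Z) (h : LinearMap.range β = LinearMap.ker δ) [IsArtinian R Z]
    (g : Y →ₗ[R] W) [IsArtinian R (LinearMap.range (g ∘ₗ β))] :
    IsArtinian R (LinearMap.range g) := by
  have hle : LinearMap.range (g ∘ₗ β) ≤ LinearMap.range g := LinearMap.range_comp_le_range _ _
  let K := (LinearMap.range (g ∘ₗ β)).comap (LinearMap.range g).subtype
  have hZ : IsArtinian R (Y ⧸ LinearMap.ker δ) := isArtinian_of_linearEquiv δ.quotKerEquivRange.symm
  let φ : (Y ⧸ LinearMap.ker δ) →ₗ[R] (LinearMap.range g ⧸ K) :=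
    Submodule.mapQ _ _ g.rangeRestrict (by
      rw [← h]
      rintro _ ⟨x, rfl⟩
      exact ⟨x, rfl⟩)
  have hφ : Function.Surjective φ := by
    intro y
    obtain ⟨⟨_, y, rfl⟩, rfl⟩ := Submodule.mkQ_surjective _ y
    exact ⟨Submodule.Quotient.mk y, rfl⟩
  have := isArtinian_of_surjective _ φ hφ
  have : IsArtinian R K := isArtinian_of_linearEquiv (Submodule.comapSubtypeEquivOfLe hle).symm
  exact isArtinian_of_range_eq_ker K.subtype K.mkQ (by simp)

end PowTorsion

section Vanishing

open Abelian

variable {R : Type u} [CommRing R] {𝔞 : Ideal R}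

/-- The short complex `A ⟶ B ⟶ B ⧸ range f`. -/
noncomputable abbrev ModuleCat.rangeQuotient {A B : ModuleCat.{u} R} (f : A ⟶ B) :
    ShortComplex (ModuleCat.{u} R) :=
  ShortComplex.mk f (ModuleCat.ofHom (LinearMap.range f.hom).mkQ) (by
    ext
    exact (Submodule.Quotient.mk_eq_zero _).mpr ⟨_, rfl⟩)

lemma ModuleCat.rangeQuotient_shortExact {A B : ModuleCat.{u} R} (f : A ⟶ B)
    (hf : Function.Injective f) : (rangeQuotient f).ShortExact :=
  ModuleCat.shortComplex_shortExact _
    (fun _ => (Submodule.Quotient.mk_eq_zero _).trans Iff.rfl) hf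
    (Submodule.mkQ_surjective _)

/-- A torsion module embeds into a torsion injective module. -/
lemma exists_injective_powTorsion_eq_top [IsNoetherianRing R] (T : ModuleCat.{u} R)
    (hT : powTorsion 𝔞 T = ⊤) :
    ∃ (E : ModuleCat.{u} R) (f : T ⟶ E),
      Injective E ∧ Function.Injective f ∧ powTorsion 𝔞 E = ⊤ := by
  have hι : Function.Injective (Injective.ι T) := (ModuleCat.mono_iff_injective _).mp inferInstance
  have : Module.Injective R (Injective.under T : ModuleCat.{u} R) :=
    Module.injective_module_of_injective_object (inj := inferInstanceAs (Injective
      (Injective.under T))) R _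
  have : Module.Injective R (powTorsion 𝔞 (Injective.under T : ModuleCat.{u} R)) :=
    (baer_powTorsion (Module.Baer.of_injective this)).injective
  refine ⟨ModuleCat.of R (powTorsion 𝔞 (Injective.under T : ModuleCat.{u} R)),
    ModuleCat.ofHom ((Injective.ι T).hom.codRestrict _ fun t => ?_),
    Module.injective_object_of_injective_module _ _,
    fun x y h => hι (congrArg Subtype.val h), powTorsion_powTorsion⟩
  obtain ⟨n, hn⟩ : t ∈ powTorsion 𝔞 T := hT ▸ Submodule.mem_top
  exact ⟨n, fun r hr => by rw [← map_smul, hn r hr, map_zero]⟩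

namespace ExtColimit

lemma map_zero_surjective {E C : ModuleCat.{u} R} (g : E ⟶ C) (hg : Function.Surjective g)
    (hE : powTorsion 𝔞 E = ⊤) : Function.Surjective (map (𝔞 := 𝔞) g 0) := by
  intro x
  obtain ⟨n, x, rfl⟩ := exists_of x
  obtain ⟨φ, rfl⟩ := (Ext.mk₀_bijective _ _).2 x
  obtain ⟨e, he⟩ := hg (φ (1 : R ⧸ 𝔞 ^ n))
  obtain ⟨m, hm⟩ : e ∈ powTorsion 𝔞 E := hE ▸ Submodule.mem_top
  let ψ : ModuleCat.of R (R ⧸ 𝔞 ^ (n + m)) ⟶ E :=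
    ModuleCat.ofHom (Submodule.liftQ _ (LinearMap.toSpanSingleton R E e) fun r hr =>
      hm r (Ideal.pow_le_pow_right (Nat.le_add_left m n) hr))
  have hψ : ψ ≫ g = quotientPowMap 𝔞 (Nat.le_add_right n m) ≫ φ := by
    ext
    change g ((1 : R) • e) = φ (1 : R ⧸ 𝔞 ^ n)
    rw [one_smul, he]
  refine ⟨of E 0 (n + m) (Ext.mk₀ ψ), ?_⟩
  rw [postcomp_of, Ext.mk₀_comp_mk₀, hψ, ← of_comp (Nat.le_add_right n m), Ext.mk₀_comp_mk₀]

variable {S : ShortComplex (ModuleCat.{u} R)}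

lemma subsingleton_X₁ (hS : S.ShortExact) (i : ℕ)
    (hg : Function.Surjective (map (𝔞 := 𝔞) S.g i)) [Subsingleton (ExtColimit 𝔞 S.X₂ (i + 1))] :
    Subsingleton (ExtColimit 𝔞 S.X₁ (i + 1)) := by
  refine subsingleton_of_forall_eq 0 fun x => ?_
  obtain ⟨y, rfl⟩ : x ∈ LinearMap.range (δ hS i) := by
    rw [range_δ]
    exact Subsingleton.elim _ _
  have : y ∈ LinearMap.ker (δ hS i) := by
    rw [← range_map_g]
    exact hg y
  exact this

/-- Positive degree local cohomology of a torsion module vanishes. -/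
lemma subsingleton_of_powTorsion_eq_top [IsNoetherianRing R] (i : ℕ) :
    ∀ (T : ModuleCat.{u} R), powTorsion 𝔞 T = ⊤ → Subsingleton (ExtColimit 𝔞 T (i + 1)) := by
  induction i with
  | zero =>
    intro T hT
    obtain ⟨E, f, hE, hf, hE'⟩ := exists_injective_powTorsion_eq_top T hT
    have : Subsingleton (ExtColimit 𝔞 (ModuleCat.rangeQuotient f).X₂ (0 + 1)) :=
      subsingleton_of_injective E 0
    have hS := ModuleCat.rangeQuotient_shortExact f hf
    exact subsingleton_X₁ hS 0 (map_zero_surjective _ hS.moduleCat_surjective_g hE')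
  | succ i ih =>
    intro T hT
    obtain ⟨E, f, hE, hf, hE'⟩ := exists_injective_powTorsion_eq_top T hT
    have : Subsingleton (ExtColimit 𝔞 (ModuleCat.rangeQuotient f).X₂ (i + 1 + 1)) :=
      subsingleton_of_injective E (i + 1)
    have : Subsingleton (ExtColimit 𝔞 (ModuleCat.rangeQuotient f).X₃ (i + 1)) :=
      ih _ (powTorsion_eq_top_of_surjective _ (Submodule.mkQ_surjective _) hE')
    exact subsingleton_X₁ (ModuleCat.rangeQuotient_shortExact f hf) (i + 1)
      (Function.surjective_to_subsingleton _)

end ExtColimit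

end Vanishing

section Artinian

variable {R : Type u} [CommRing R] {𝔞 : Ideal R}

namespace ExtColimit

/-- Powers of elements of `𝔞` eventually have Artinian image on `ExtColimit 𝔞 M i`. -/
def HasArtinianPowers (𝔞 : Ideal R) (M : ModuleCat.{u} R) (i : ℕ) : Prop :=
  ∀ x ∈ 𝔞, ∃ k : ℕ, IsArtinian R
    (LinearMap.range (LinearMap.lsmul R (ExtColimit 𝔞 M i) (x ^ k)))

variable {S : ShortComplex (ModuleCat.{u} R)} (hS : S.ShortExact) {q : ℕ}

include hS in
lemma isArtinian_X₃ {i : ℕ} [IsArtinian R (ExtColimit 𝔞 S.X₁ (i + 1))]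
    [IsArtinian R (ExtColimit 𝔞 S.X₂ i)] : IsArtinian R (ExtColimit 𝔞 S.X₃ i) :=
  isArtinian_of_range_eq_ker _ _ (range_map_g hS i)

include hS in
lemma hasArtinianPowers_X₃ {i : ℕ} [IsArtinian R (ExtColimit 𝔞 S.X₁ (i + 1))]
    (h : HasArtinianPowers 𝔞 S.X₂ i) : HasArtinianPowers 𝔞 S.X₃ i := by
  intro x hx
  obtain ⟨k, hk⟩ := h x hx
  refine ⟨k, ?_⟩
  have hcomm : LinearMap.lsmul R (ExtColimit 𝔞 S.X₃ i) (x ^ k) ∘ₗ map S.g i =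
      map S.g i ∘ₗ LinearMap.lsmul R (ExtColimit 𝔞 S.X₂ i) (x ^ k) := by
    ext y
    simp
  have : IsArtinian R (LinearMap.range
      (LinearMap.lsmul R (ExtColimit 𝔞 S.X₃ i) (x ^ k) ∘ₗ map S.g i)) := by
    rw [hcomm, LinearMap.range_comp]
    exact isArtinian_of_surjective _ ((map S.g i).submoduleMap _)
      (LinearMap.submoduleMap_surjective _ _)
  exact isArtinian_range_of_exact _ _ (range_map_g hS i) _

include hS in
lemma isArtinian_X₂ {i : ℕ} [IsArtinian R (LinearMap.range (map (𝔞 := 𝔞) S.f i))]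
    [IsArtinian R (ExtColimit 𝔞 S.X₃ i)] : IsArtinian R (ExtColimit 𝔞 S.X₂ i) :=
  isArtinian_of_range_eq_ker (LinearMap.range (map S.f i)).subtype (map S.g i)
    (by rw [Submodule.range_subtype, range_map_f hS])

/-- If the local cohomology of `N` is Artinian above a positive degree `q` and powers of elements
of `𝔞` have Artinian image in degree `q`, then it is Artinian in degree `q`. -/
theorem isArtinian_of_hasArtinianPowers [IsNoetherianRing R] (q : ℕ) (N : ModuleCat.{u} R)
    [Module.Finite R N] : (∀ i, q + 1 < i → IsArtinian R (ExtColimit 𝔞 N i)) →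
      HasArtinianPowers 𝔞 N (q + 1) → IsArtinian R (ExtColimit 𝔞 N (q + 1)) := by
  induction N using ModuleCat.noetherian_quotient_induction with
  | h M ih =>
  intro hM hq
  have step : ∀ (A : ModuleCat.{u} R) (f : A ⟶ M), Function.Injective f →
      LinearMap.range f.hom ≠ ⊥ → (∀ i, q + 1 < i → IsArtinian R (ExtColimit 𝔞 A i)) →
      IsArtinian R (LinearMap.range (map (𝔞 := 𝔞) f (q + 1))) →
      IsArtinian R (ExtColimit 𝔞 M (q + 1)) := by
    intro A f hf hne hA hrange
    have hS := ModuleCat.rangeQuotient_shortExact f hf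
    have h₃ : IsArtinian R (ExtColimit 𝔞 (ModuleCat.rangeQuotient f).X₃ (q + 1)) := by
      refine ih _ hne (fun i hi => ?_) ?_
      · have : IsArtinian R (ExtColimit 𝔞 (ModuleCat.rangeQuotient f).X₁ (i + 1)) :=
          hA (i + 1) (by lia)
        have : IsArtinian R (ExtColimit 𝔞 (ModuleCat.rangeQuotient f).X₂ i) := hM i hi
        exact isArtinian_X₃ hS
      · have : IsArtinian R (ExtColimit 𝔞 (ModuleCat.rangeQuotient f).X₁ (q + 1 + 1)) :=
          hA (q + 1 + 1) (by lia)
        exact hasArtinianPowers_X₃ hS hq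
    exact isArtinian_X₂ hS
  by_cases htors : powTorsion 𝔞 M = ⊥
  · obtain ⟨x, hx, hreg⟩ := exists_mem_isSMulRegular htors
    obtain ⟨k, hk⟩ := hq x hx
    have hinj : Function.Injective ((x ^ k • 𝟙 M : M ⟶ M)) := hreg.pow k
    by_cases hzero : LinearMap.range (x ^ k • 𝟙 M : M ⟶ M).hom = ⊥
    · have : Subsingleton M := subsingleton_of_forall_eq 0 fun m => hinj <| by
        rw [map_zero]
        exact (Submodule.mem_bot R).mp (hzero ▸ LinearMap.mem_range_self _ m)
      have := subsingleton_of_isZero (𝔞 := 𝔞) M (ModuleCat.isZero_of_subsingleton M) (q + 1)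
      infer_instance
    · refine step M _ hinj hzero hM ?_
      have : map (𝔞 := 𝔞) (x ^ k • 𝟙 M) (q + 1) = LinearMap.lsmul R _ (x ^ k) :=
        LinearMap.ext (map_smul_id M (q + 1) (x ^ k))
      rwa [this]
  · have hsub (i : ℕ) : Subsingleton (ExtColimit 𝔞 (ModuleCat.of R (powTorsion 𝔞 M)) (i + 1)) :=
      subsingleton_of_powTorsion_eq_top i _ powTorsion_powTorsion
    refine step (ModuleCat.of R (powTorsion 𝔞 M)) (ModuleCat.ofHom (powTorsion 𝔞 M).subtype)
      Subtype.val_injective ?_ (fun i hi => ?_) ?_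
    · rwa [ModuleCat.hom_ofHom, Submodule.range_subtype]
    · obtain ⟨j, rfl⟩ : ∃ j, i = j + 1 := ⟨i - 1, by lia⟩
      infer_instance
    · exact isArtinian_of_surjective _ (LinearMap.rangeRestrict _)
        (LinearMap.surjective_rangeRestrict _)

lemma powTorsion_extColimit (N : ModuleCat.{u} R) (i : ℕ) :
    powTorsion 𝔞 (ExtColimit 𝔞 N i) = ⊤ :=
  Submodule.eq_top_iff'.mpr exists_pow_smul_eq_zero

lemma hasArtinianPowers_of_finite (N : ModuleCat.{u} R) (i : ℕ)
    [Module.Finite R (ExtColimit 𝔞 N i)] : HasArtinianPowers 𝔞 N i := by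
  obtain ⟨n, hn⟩ := exists_pow_smul_eq_zero_of_fg (Module.Finite.fg_top (R := R)
    (M := ExtColimit 𝔞 N i)) (powTorsion_extColimit (𝔞 := 𝔞) N i).ge
  intro x hx
  refine ⟨n, ?_⟩
  have : LinearMap.lsmul R (ExtColimit 𝔞 N i) (x ^ n) = 0 :=
    LinearMap.ext fun y => hn _ (Ideal.pow_mem_pow hx n) y Submodule.mem_top
  rw [this, LinearMap.range_zero]
  infer_instance

end ExtColimit

end Artinian

theorem finiteness_dim_le_artinianness_dim
    {R : Type u} [CommRing R] [IsNoetherianRing R]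
    (𝔞 : Ideal R) (N : Type u) [AddCommGroup N] [Module R N] [Module.Finite R N]
    (h_dim : Order.krullDim ↥(Module.support R N) ≠ ⊤)
    (q : ℕ) (h_pos : 0 < q)
    (h_not_art : ¬ IsArtinian R ((localCohomology 𝔞 q).obj (ModuleCat.of R N)))
    (h_art : ∀ i, q < i → IsArtinian R ((localCohomology 𝔞 i).obj (ModuleCat.of R N))) :
    ∃ i ≤ q, ¬ Module.Finite R ((localCohomology 𝔞 i).obj (ModuleCat.of R N)) := by
  refine ⟨q, le_rfl, fun hfin => h_not_art ?_⟩
  obtain ⟨p, rfl⟩ : ∃ p, q = p + 1 := ⟨q - 1, by lia⟩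
  have : Module.Finite R (ExtColimit 𝔞 (ModuleCat.of R N) (p + 1)) :=
    Module.Finite.equiv (ExtColimit.equivLocalCohomology 𝔞 p (ModuleCat.of R N)).symm
  have : IsArtinian R (ExtColimit 𝔞 (ModuleCat.of R N) (p + 1)) := by
    refine ExtColimit.isArtinian_of_hasArtinianPowers p _ (fun i hi => ?_)
      (ExtColimit.hasArtinianPowers_of_finite _ _)
    obtain ⟨j, rfl⟩ : ∃ j, i = j + 1 := ⟨i - 1, by lia⟩
    have := h_art (j + 1) hi
    exact isArtinian_of_linearEquiv (ExtColimit.equivLocalCohomology 𝔞 j (ModuleCat.of R N)).symm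
  exact isArtinian_of_linearEquiv (ExtColimit.equivLocalCohomology 𝔞 p (ModuleCat.of R N))
end
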